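/- arXiv:1611.00216 — 3 statements merged into one kernel-verified Lean document; each statement's English description precedes it below -/
import Mathlib

section
/- Let λ = (λ_1,…,λ_n) be a partition with n parts and smallest part λ_n ≥ 2. If P(s_λ ↦ 0) = 1/q, then λ has at most two distinct part sizes; that is, there exists 1 ≤ m ≤ n such that λ_1 = λ_2 = … = λ_m and λ_{m+1} = … = λ_n, i.e. λ = (λ_1^m, λ_n^{n−m}). -/
open Finset Classical

/-- The Jacobi–Trudi matrix of a partition with `k` parts `lam 0 ≥ lam 1 ≥ …`,
with respect to a 1-indexed assignment `a : ℕ → F` of values to `h_1, h_2, …`.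
The `(i,j)` entry (indices `0`-based) is `a (lam i - i + j)` if that subscript is `≥ 1`,
is `1` if it is `0`, and is `0` if it is negative. -/
def JTmat (F : Type*) [Field F] (k : ℕ) (lam : ℕ → ℕ) (a : ℕ → F) :
    Matrix (Fin k) (Fin k) F :=
  Matrix.of fun i j =>
    if 1 ≤ (lam i : ℤ) - (i : ℤ) + (j : ℤ) then
      a ((lam i : ℤ) - (i : ℤ) + (j : ℤ)).toNat
    else if (lam i : ℤ) - (i : ℤ) + (j : ℤ) = 0 then 1 else 0

/-- Extend a tuple `b : Fin N → F` to a `1`-indexed assignment `ℕ → F`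
(zero outside `{1, …, N}`). -/
def extFin {F : Type*} [Zero F] {N : ℕ} (b : Fin N → F) : ℕ → F :=
  fun n => if h : 1 ≤ n ∧ n ≤ N then b ⟨n - 1, by omega⟩ else 0

/-- The probability that the Jacobi–Trudi determinant of the partition `lam`
(with `k` parts) equals `c`, when the values of `h_1, …, h_N` are chosen
uniformly at random in `F`. -/
noncomputable def probEq (F : Type*) [Field F] [Fintype F]
    (k : ℕ) (lam : ℕ → ℕ) (N : ℕ) (c : F) : ℚ :=
  ((Finset.univ.filter fun b : Fin N → F =>
      (JTmat F k lam (extFin b)).det = c).card : ℚ) / (Fintype.card F : ℚ) ^ N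

/-- `lam` records a partition with `k` (positive, weakly decreasing) parts
on the indices `0, …, k-1`. -/
def IsPartition (k : ℕ) (lam : ℕ → ℕ) : Prop :=
  (∀ i, i + 1 < k → lam (i + 1) ≤ lam i) ∧ ∀ i, i < k → 1 ≤ lam i

section Exposure

variable {F : Type*}

theorem update_agree {t : ℤ} {a b : ℤ → F} {x : F}
    (h : ∀ m < t + 1, b m = Function.update a t x m) : ∀ m < t, b m = a m := fun m hm => by
  rw [h m (by omega), Function.update_of_ne hm.ne]

variable [Fintype F]

/-- The probability that `Q` holds when the values `a t, …, a (t + k - 1)` are redrawn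
uniformly at random, one after the other, and the other values of `a` are kept. -/
noncomputable def exposureProb (Q : (ℤ → F) → Prop) : ℕ → ℤ → (ℤ → F) → ℚ
  | 0, _, a => if Q a then 1 else 0
  | k + 1, t, a =>
    (∑ x, exposureProb Q k (t + 1) (Function.update a t x)) / Fintype.card F

theorem card_cast_pos [Nonempty F] : (0 : ℚ) < Fintype.card F := by
  exact_mod_cast Fintype.card_pos

theorem exposureProb_congr {Q Q' : (ℤ → F) → Prop} (k : ℕ) (t : ℤ) (a : ℤ → F)
    (h : ∀ b : ℤ → F, (∀ m < t, b m = a m) → (Q b ↔ Q' b)) :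
    exposureProb Q k t a = exposureProb Q' k t a := by
  induction k generalizing t a with
  | zero => simp only [exposureProb, h a fun _ _ => rfl]
  | succ k ih =>
    simp only [exposureProb]
    congr 1
    exact Finset.sum_congr rfl fun x _ => ih _ _ fun b hb => h b (update_agree hb)

theorem exposureProb_eq_one [Nonempty F] {Q : (ℤ → F) → Prop} (k : ℕ) (t : ℤ) (a : ℤ → F)
    (h : ∀ b : ℤ → F, (∀ m < t, b m = a m) → Q b) : exposureProb Q k t a = 1 := by
  induction k generalizing t a with
  | zero => simp only [exposureProb, h a fun _ _ => rfl, if_true]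
  | succ k ih =>
    simp only [exposureProb]
    rw [Finset.sum_congr rfl fun x _ => ih _ _ fun b hb => h b (update_agree hb)]
    have := card_cast_pos (F := F)
    simp [this.ne']

theorem exposureProb_nonneg (Q : (ℤ → F) → Prop) (k : ℕ) (t : ℤ) (a : ℤ → F) :
    0 ≤ exposureProb Q k t a := by
  induction k generalizing t a with
  | zero => simp only [exposureProb]; split_ifs <;> norm_num
  | succ k ih => exact div_nonneg (Finset.sum_nonneg fun x _ => ih _ _) (by positivity)

theorem le_exposureProb_succ [Nonempty F] {Q : (ℤ → F) → Prop} {k : ℕ} {t : ℤ}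
    {a : ℤ → F} {r : ℚ}
    (h : ∀ x, r ≤ exposureProb Q k (t + 1) (Function.update a t x)) :
    r ≤ exposureProb Q (k + 1) t a := by
  rw [exposureProb, le_div_iff₀ card_cast_pos]
  calc r * Fintype.card F = ∑ _x : F, r := by simp [mul_comm]
    _ ≤ _ := Finset.sum_le_sum fun x _ => h x

theorem lt_exposureProb_succ [Nonempty F] {Q : (ℤ → F) → Prop} {k : ℕ} {t : ℤ}
    {a : ℤ → F} {r : ℚ}
    (h : ∀ x, r ≤ exposureProb Q k (t + 1) (Function.update a t x))
    (h' : ∃ x, r < exposureProb Q k (t + 1) (Function.update a t x)) :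
    r < exposureProb Q (k + 1) t a := by
  rw [exposureProb, lt_div_iff₀ card_cast_pos]
  obtain ⟨x, hx⟩ := h'
  calc r * Fintype.card F = ∑ _x : F, r := by simp [mul_comm]
    _ < _ := Finset.sum_lt_sum (fun x _ => h x) ⟨x, Finset.mem_univ x, hx⟩

theorem inv_card_le_exposureProb_succ [Nonempty F] {Q : (ℤ → F) → Prop} {k : ℕ} {t : ℤ}
    {a : ℤ → F} (x : F)
    (h : exposureProb Q k (t + 1) (Function.update a t x) = 1) :
    1 / (Fintype.card F : ℚ) ≤ exposureProb Q (k + 1) t a := by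
  rw [exposureProb, div_le_div_iff_of_pos_right card_cast_pos, ← h]
  exact Finset.single_le_sum
    (f := fun x => exposureProb Q k (t + 1) (Function.update a t x))
    (fun _ _ => exposureProb_nonneg _ _ _ _) (Finset.mem_univ x)

theorem inv_card_lt_exposureProb_succ [Nonempty F] {Q : (ℤ → F) → Prop} {k : ℕ} {t : ℤ}
    {a : ℤ → F} {x y : F}
    (hxy : x ≠ y) (hx : exposureProb Q k (t + 1) (Function.update a t x) = 1)
    (hy : 0 < exposureProb Q k (t + 1) (Function.update a t y)) :
    1 / (Fintype.card F : ℚ) < exposureProb Q (k + 1) t a := by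
  rw [exposureProb, div_lt_div_iff_of_pos_right card_cast_pos, ← hx]
  exact Finset.single_lt_sum
    (f := fun x => exposureProb Q k (t + 1) (Function.update a t x)) hxy.symm
    (Finset.mem_univ x) (Finset.mem_univ y) hy fun _ _ _ => exposureProb_nonneg _ _ _ _

theorem exposureProb_eq_card_div (Q : (ℤ → F) → Prop) (k : ℕ) (t : ℤ) (a : ℤ → F) :
    exposureProb Q k t a = ((Finset.univ.filter fun b : Fin k → F =>
      Q fun m => if h : t ≤ m ∧ m < t + k then b ⟨(m - t).toNat, by omega⟩ else a m).card : ℚ) /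
        (Fintype.card F : ℚ) ^ k := by
  induction k generalizing t a with
  | zero =>
    have : (fun m : ℤ => if h : t ≤ m ∧ m < t + (0 : ℕ) then
        (default : Fin 0 → F) ⟨(m - t).toNat, by omega⟩ else a m) = a := by
      funext m
      rw [dif_neg (by push_cast; omega)]
    simp only [exposureProb, Finset.card_filter, Fintype.sum_unique, this]
    split_ifs <;> simp
  | succ k ih =>
    simp only [exposureProb, ih, Finset.card_filter]
    rw [← Finset.sum_div, div_div, ← pow_succ, ← (Fin.consEquiv fun _ => F).sum_comp,
      Fintype.sum_prod_type]
    push_cast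
    congr 1
    refine Finset.sum_congr rfl fun x _ => Finset.sum_congr rfl fun b _ => ?_
    congr 2
    funext m
    simp only [Fin.consEquiv, Equiv.coe_fn_mk]
    rcases lt_trichotomy m t with hm | rfl | hm
    · rw [dif_neg (by omega), dif_neg (by omega), Function.update_of_ne hm.ne]
    · rw [dif_neg (by omega), dif_pos (by omega), Function.update_self]
      have : (⟨(m - m).toNat, by omega⟩ : Fin (k + 1)) = 0 := by ext; simp
      rw [this, Fin.cons_zero]
    · by_cases h : m < t + k + 1
      · rw [dif_pos (by omega), dif_pos (by omega)]
        have : (⟨(m - t).toNat, by omega⟩ : Fin (k + 1)) =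
            Fin.succ ⟨(m - (t + 1)).toNat, by omega⟩ := by ext; simp; omega
        rw [this, Fin.cons_succ]
      · rw [dif_neg (by omega), dif_neg (by omega), Function.update_of_ne hm.ne']

end Exposure

section Pivot

variable {F : Type*} [Field F] {ι : Type}

theorem det_eq_zero_iff_schur [Fintype ι] [DecidableEq ι] {A : Matrix ι ι F} {i₀ : ι}
    (h : A i₀ i₀ ≠ 0) :
    A.det = 0 ↔ (Matrix.of fun i j : {i // i ≠ i₀} =>
      A i j - A i i₀ * A i₀ j / A i₀ i₀).det = 0 := by
  have hsum : ∀ (f : ι → F), ∑ i, f i = f i₀ + ∑ i : {i // i ≠ i₀}, f i := fun f => by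
    rw [← Finset.add_sum_erase _ _ (Finset.mem_univ i₀)]
    congr 1
    exact Finset.sum_subtype _ (by simp) f
  rw [← Matrix.exists_mulVec_eq_zero_iff, ← Matrix.exists_mulVec_eq_zero_iff]
  constructor
  · rintro ⟨v, hv, hAv⟩
    have key : ∀ i, A i i₀ * v i₀ + ∑ j : {i // i ≠ i₀}, A i j * v j = 0 := fun i => by
      rw [← hsum fun j => A i j * v j]
      exact congrFun hAv i
    refine ⟨fun j => v j, fun h0 => hv ?_, ?_⟩
    · have hz : ∀ j : {i // i ≠ i₀}, v j = 0 := fun j => congrFun h0 j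
      funext i
      by_cases hi : i = i₀
      · subst hi
        have := key i
        simp only [hz, mul_zero, Finset.sum_const_zero, add_zero] at this
        simpa [h] using this
      · exact hz ⟨i, hi⟩
    · funext i
      have h1 := key i
      have h2 := key i₀
      simp only [Matrix.mulVec, dotProduct, Matrix.of_apply, sub_mul, Finset.sum_sub_distrib,
        Pi.zero_apply]
      have : ∑ j : {i // i ≠ i₀}, A i i₀ * A i₀ j / A i₀ i₀ * v j =
          A i i₀ / A i₀ i₀ * ∑ j : {i // i ≠ i₀}, A i₀ j * v j := by
        rw [Finset.mul_sum]
        exact Finset.sum_congr rfl fun j _ => by ring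
      rw [this, eq_neg_of_add_eq_zero_right h1, eq_neg_of_add_eq_zero_right h2]
      field_simp
      ring
  · rintro ⟨v, hv, hAv⟩
    have key : ∀ i : {i // i ≠ i₀}, ∑ j : {i // i ≠ i₀}, A i j * v j =
        A i i₀ / A i₀ i₀ * ∑ j : {i // i ≠ i₀}, A i₀ j * v j := fun i => by
      have := congrFun hAv i
      simp only [Matrix.mulVec, dotProduct, Matrix.of_apply, sub_mul, Finset.sum_sub_distrib,
        Pi.zero_apply] at this
      rw [sub_eq_zero.1 this, Finset.mul_sum]
      exact Finset.sum_congr rfl fun j _ => by ring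
    set s := ∑ j : {i // i ≠ i₀}, A i₀ j * v j with hs
    refine ⟨fun i => if hi : i = i₀ then -s / A i₀ i₀ else v ⟨i, hi⟩, fun h0 => hv ?_, ?_⟩
    · funext i
      have := congrFun h0 i
      simpa [i.2] using this
    · funext i
      simp only [Matrix.mulVec, dotProduct, Pi.zero_apply]
      rw [hsum]
      have h1 : ∑ j : {i // i ≠ i₀}, A i j *
          (if hi : (j : ι) = i₀ then -s / A i₀ i₀ else v ⟨j, hi⟩) =
          ∑ j : {i // i ≠ i₀}, A i j * v j :=
        Finset.sum_congr rfl fun j _ => by rw [dif_neg j.2]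
      rw [h1, dif_pos rfl]
      by_cases hi : i = i₀
      · subst hi
        rw [← hs]
        field_simp
        ring
      · rw [key ⟨i, hi⟩]
        field_simp
        ring

theorem det_eq_zero_of_zero_block [Fintype ι] [DecidableEq ι] {A : Matrix ι ι F}
    (R C : Finset ι)
    (hcard : Fintype.card ι < R.card + C.card) (h : ∀ i ∈ R, ∀ j ∈ C, A i j = 0) :
    A.det = 0 := by
  rw [← Matrix.det_transpose, Matrix.det_apply]
  refine Finset.sum_eq_zero fun σ _ => ?_
  have : ∃ i ∈ R, σ i ∈ C := by
    by_contra! hno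
    have hdisj : Disjoint (R.map σ.toEmbedding) C := by
      rw [Finset.disjoint_left]
      intro x hx
      obtain ⟨i, hi, rfl⟩ := Finset.mem_map.1 hx
      exact hno i hi
    have := Finset.card_le_univ ((R.map σ.toEmbedding).disjUnion C hdisj)
    rw [Finset.card_disjUnion, Finset.card_map] at this
    omega
  obtain ⟨i, hi, hi'⟩ := this
  rw [Finset.prod_eq_zero (Finset.mem_univ i) (by simpa using h i hi _ hi'), smul_zero]

/-- The `(i, j)` entry of `M a` is `a (α i + β j)` plus a function of the values of `a` at
smaller arguments. -/
def IsLeading (M : (ℤ → F) → Matrix ι ι F) (α β : ι → ℤ) : Prop :=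
  ∀ i j, ∀ a b : ℤ → F, (∀ m < α i + β j, a m = b m) →
    M a i j - a (α i + β j) = M b i j - b (α i + β j)

theorem IsLeading.eq_of_agree {M : (ℤ → F) → Matrix ι ι F} {α β : ι → ℤ} (hM : IsLeading M α β)
    {i j : ι} {t : ℤ} (ht : α i + β j < t) {a b : ℤ → F} (hab : ∀ m < t, a m = b m) :
    M a i j = M b i j := by
  have := hM i j a b fun m hm => hab m (by omega)
  rwa [hab _ ht, sub_left_inj] at this

theorem IsLeading.permute {M : (ℤ → F) → Matrix ι ι F} {α β : ι → ℤ} (hM : IsLeading M α β)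
    (σ : Equiv.Perm ι) : IsLeading (fun a => (M a).submatrix id σ) α (β ∘ σ) :=
  fun i j => hM i (σ j)

theorem det_permute_eq_zero_iff [Fintype ι] [DecidableEq ι] (A : Matrix ι ι F)
    (σ : Equiv.Perm ι) :
    (A.submatrix id σ).det = 0 ↔ A.det = 0 := by
  rw [Matrix.det_permute']
  rcases Int.units_eq_one_or (Equiv.Perm.sign σ) with h | h <;> simp [h]

/-- The Schur complement with respect to the diagonal entry at `i₀`, applied only to the entries
whose row and column weights exceed those of `i₀`. -/
def pivot (M : (ℤ → F) → Matrix ι ι F) (α β : ι → ℤ) (i₀ : ι) (a : ℤ → F) :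
    Matrix {i // i ≠ i₀} {i // i ≠ i₀} F :=
  Matrix.of fun i j => if α i₀ < α i ∧ β i₀ < β j then
    M a i j - M a i i₀ * M a i₀ j / M a i₀ i₀ else M a i j

theorem IsLeading.pivot {M : (ℤ → F) → Matrix ι ι F} {α β : ι → ℤ} (hM : IsLeading M α β)
    (i₀ : ι) : IsLeading (pivot M α β i₀) (fun i => α i) (fun i => β i) := by
  intro i j a b hab
  dsimp only at hab ⊢
  simp only [_root_.pivot, Matrix.of_apply]
  split_ifs with h
  · rw [hM.eq_of_agree (i := i) (j := i₀) (by omega) hab,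
      hM.eq_of_agree (i := i₀) (j := j) (by omega) hab,
      hM.eq_of_agree (i := i₀) (j := i₀) (by omega) hab]
    linear_combination hM i j a b hab
  · exact hM i j a b hab

theorem pivot_apply {M : (ℤ → F) → Matrix ι ι F} {α β : ι → ℤ}
    (hα : Function.Injective α) (hβ : Function.Injective β) {i₀ : ι} {a : ℤ → F}
    (hcol : ∀ i, α i < α i₀ → M a i i₀ = 0) (hrow : ∀ j, β j < β i₀ → M a i₀ j = 0)
    (i j : {i // i ≠ i₀}) :
    pivot M α β i₀ a i j = M a i j - M a i i₀ * M a i₀ j / M a i₀ i₀ := by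
  simp only [pivot, Matrix.of_apply]
  split_ifs with h
  · rfl
  · have h1 : α i ≠ α i₀ := fun h => i.2 (hα h)
    have h2 : β j ≠ β i₀ := fun h => j.2 (hβ h)
    rcases lt_or_gt_of_ne h1 with h1 | h1
    · simp [hcol _ h1]
    · rcases lt_or_gt_of_ne h2 with h2 | h2
      · simp [hrow _ h2]
      · exact absurd ⟨h1, h2⟩ h

theorem det_pivot_eq_zero_iff [Fintype ι] [DecidableEq ι]
    {M : (ℤ → F) → Matrix ι ι F} {α β : ι → ℤ} (hα : Function.Injective α)
    (hβ : Function.Injective β) (hM : IsLeading M α β) {i₀ : ι}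
    {t : ℤ} {a : ℤ → F} (ht : α i₀ + β i₀ < t) (h : M a i₀ i₀ ≠ 0)
    (hcol : ∀ i, α i < α i₀ → M a i i₀ = 0) (hrow : ∀ j, β j < β i₀ → M a i₀ j = 0)
    {b : ℤ → F} (hb : ∀ m < t, b m = a m) :
    (M b).det = 0 ↔ (pivot M α β i₀ b).det = 0 := by
  rw [det_eq_zero_iff_schur (i₀ := i₀) (by rwa [hM.eq_of_agree ht hb])]
  have : (Matrix.of fun i j : {i // i ≠ i₀} => M b i j - M b i i₀ * M b i₀ j / M b i₀ i₀) =
      pivot M α β i₀ b := by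
    ext i j
    rw [pivot_apply hα hβ]
    · rfl
    · intro i hi
      rw [hM.eq_of_agree (by omega) hb, hcol i hi]
    · intro j hj
      rw [hM.eq_of_agree (by omega) hb, hrow j hj]
  rw [this]

end Pivot

section Bounds

theorem exists_perm_blocked {ι : Type} [Fintype ι] {α β : ι → ℤ} {t : ℤ}
    (h : ∀ i, t ≤ α i + β i) :
    ∃ σ : Equiv.Perm ι, (∀ i, t ≤ α i + β (σ i)) ∧
      ((∀ i, t < α i + β (σ i)) ∨
        ∃ i₀, α i₀ + β (σ i₀) = t ∧ ∀ j, α j ≤ α i₀ ∨ β (σ j) ≤ β (σ i₀)) := by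
  obtain ⟨σ, hσ, hmin⟩ := Finset.exists_min_image
    (Finset.univ.filter fun σ : Equiv.Perm ι => ∀ i, t ≤ α i + β (σ i))
    (fun σ => (Finset.univ.filter fun i => α i + β (σ i) = t).card) ⟨1, by simpa using h⟩
  simp only [Finset.mem_filter, Finset.mem_univ, true_and] at hσ hmin
  refine ⟨σ, hσ, ?_⟩
  by_contra! hcon
  obtain ⟨⟨i₀, hi₀⟩, hblock⟩ := hcon
  have hi₀ : α i₀ + β (σ i₀) = t := le_antisymm hi₀ (hσ i₀)
  obtain ⟨j, hj, hj'⟩ := hblock i₀ hi₀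
  have hne : j ≠ i₀ := by rintro rfl; omega
  have hval : ∀ i, i ≠ i₀ → i ≠ j → (σ * Equiv.swap i₀ j) i = σ i := fun i h1 h2 => by
    rw [Equiv.Perm.mul_apply, Equiv.swap_apply_of_ne_of_ne h1 h2]
  have hval₀ : (σ * Equiv.swap i₀ j) i₀ = σ j := by simp
  have hvalj : (σ * Equiv.swap i₀ j) j = σ i₀ := by simp
  have := hmin (σ * Equiv.swap i₀ j) fun i => by
    by_cases h1 : i = i₀
    · subst h1; rw [hval₀]; omega
    · by_cases h2 : i = j
      · subst h2; rw [hvalj]; omega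
      · rw [hval i h1 h2]; exact hσ i
  refine absurd this (not_le.2 (Finset.card_lt_card ?_))
  rw [Finset.ssubset_iff_of_subset]
  · refine ⟨i₀, by simpa using hi₀, ?_⟩
    simp only [Finset.mem_filter, Finset.mem_univ, true_and, hval₀]
    omega
  · intro i
    simp only [Finset.mem_filter, Finset.mem_univ, true_and]
    intro hi
    by_cases h1 : i = i₀
    · subst h1; exact hi₀
    · by_cases h2 : i = j
      · subst h2; rw [hvalj] at hi; omega
      · rwa [hval i h1 h2] at hi

variable {F : Type*} [Field F]

theorem det_eq_zero_of_blocked {ι : Type} [Fintype ι] [DecidableEq ι]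
    {M : (ℤ → F) → Matrix ι ι F} {α β : ι → ℤ} (hα : Function.Injective α)
    (hβ : Function.Injective β) (hM : IsLeading M α β) {t : ℤ} {a : ℤ → F}
    (hz : ∀ i j, α i + β j < t → M a i j = 0) {i₀ : ι} (hi₀ : α i₀ + β i₀ = t)
    (hblock : ∀ j, α j ≤ α i₀ ∨ β j ≤ β i₀) (h₀ : M a i₀ i₀ = 0) {b : ℤ → F}
    (hb : ∀ m < t + 1, b m = a m) : (M b).det = 0 := by
  refine det_eq_zero_of_zero_block (Finset.univ.filter fun i => α i ≤ α i₀)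
    (Finset.univ.filter fun j => β j ≤ β i₀) ?_ ?_
  · have hunion : (Finset.univ.filter fun i => α i ≤ α i₀) ∪
        (Finset.univ.filter fun j => β j ≤ β i₀) = Finset.univ := by
      ext j; simpa using hblock j
    have hinter : 0 < ((Finset.univ.filter fun i => α i ≤ α i₀) ∩
        (Finset.univ.filter fun j => β j ≤ β i₀)).card :=
      Finset.card_pos.2 ⟨i₀, by simp⟩
    rw [← Finset.card_union_add_card_inter, hunion, Finset.card_univ]
    omega
  · simp only [Finset.mem_filter, Finset.mem_univ, true_and]
    intro i hi j hj
    rw [hM.eq_of_agree (t := t + 1) (by omega) hb]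
    by_cases h : α i + β j < t
    · exact hz i j h
    · rw [hα (show α i = α i₀ by omega), hβ (show β j = β i₀ by omega), h₀]

theorem IsLeading.exists_update_eq_zero {ι : Type} {M : (ℤ → F) → Matrix ι ι F} {α β : ι → ℤ}
    (hM : IsLeading M α β) (a : ℤ → F) (i j : ι) :
    ∃ x, ∀ y, M (Function.update a (α i + β j) y) i j = 0 ↔ y = x := by
  refine ⟨a (α i + β j) - M a i j, fun y => ?_⟩
  have := hM i j (Function.update a (α i + β j) y) a fun m hm => Function.update_of_ne hm.ne _ _
  rw [Function.update_self] at this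
  rw [eq_add_of_sub_eq this]
  constructor <;> intro h <;> linear_combination h

/-- If, at the sequence `a`, the rows in `R` are unit vectors with ones on the diagonal, then
these rows and the corresponding columns can be eliminated. -/
theorem exists_eliminated {t : ℤ} {a : ℤ → F} (n : ℕ) : ∀ (ι : Type) [Fintype ι] [DecidableEq ι]
    (R : Finset ι) (_ : R.card = n) (M : (ℤ → F) → Matrix ι ι F) (α β : ι → ℤ)
    (_ : Function.Injective α) (_ : Function.Injective β) (_ : IsLeading M α β)
    (_ : ∀ i ∈ R, α i + β i < t) (_ : ∀ i ∈ R, ∀ j, M a i j = if j = i then 1 else 0)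
    (_ : ∀ i ∈ R, ∀ j, j ∉ R → α i < α j) (κ : Type) [Fintype κ] [DecidableEq κ] (f : κ → ι)
    (_ : Function.Injective f) (_ : ∀ i, i ∉ R ↔ ∃ x, f x = i),
    ∃ M' : (ℤ → F) → Matrix κ κ F, IsLeading M' (α ∘ f) (β ∘ f) ∧
      M' a = (M a).submatrix f f ∧
      ∀ b : ℤ → F, (∀ m < t, b m = a m) → ((M b).det = 0 ↔ (M' b).det = 0) := by
  induction n with
  | zero =>
    intro ι _ _ R hcard M α β _ _ hM _ _ _ κ _ _ f hf hR
    refine ⟨fun b => (M b).submatrix f f, fun i j => hM _ _, rfl, fun b _ => ?_⟩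
    have hbij : Function.Bijective f :=
      ⟨hf, fun i => (hR i).1 (by simp [Finset.card_eq_zero.1 hcard])⟩
    rw [← Matrix.det_submatrix_equiv_self (Equiv.ofBijective f hbij) (M b)]
    rfl
  | succ n ih =>
    intro ι _ _ R hcard M α β hα hβ hM hw hunit hlow κ _ _ f hf hR
    obtain ⟨i₀, hi₀⟩ : R.Nonempty := Finset.card_pos.1 (by omega)
    have hfne : ∀ x, f x ≠ i₀ := fun x hx => (hR i₀).2 ⟨x, hx⟩ hi₀
    have hone : M a i₀ i₀ = 1 := by simp [hunit i₀ hi₀]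
    have hrow : ∀ j, j ≠ i₀ → M a i₀ j = 0 := fun j hj => by simp [hunit i₀ hi₀, hj]
    have hrow' : ∀ j, β j < β i₀ → M a i₀ j = 0 := fun j hj =>
      hrow j (by rintro rfl; exact hj.false)
    have hcol : ∀ i, α i < α i₀ → M a i i₀ = 0 := fun i hi => by
      have hiR : i ∈ R := by
        by_contra h
        exact absurd (hlow i₀ hi₀ i h) (by omega)
      rw [hunit i hiR, if_neg (by rintro rfl; exact hi.false)]
    have hpiv : ∀ i j, pivot M α β i₀ a i j = M a i j := fun i j => by
      rw [pivot_apply hα hβ hcol hrow', hrow j j.2]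
      simp
    obtain ⟨M', h1, h2, h3⟩ := ih {i // i ≠ i₀} (R.subtype (· ≠ i₀))
      (by
        have : R.filter (· ≠ i₀) = R.erase i₀ := by ext; simp [and_comm]
        rw [Finset.card_subtype, this, Finset.card_erase_of_mem hi₀, hcard]
        rfl)
      (pivot M α β i₀) _ _ (hα.comp Subtype.val_injective) (hβ.comp Subtype.val_injective)
      (hM.pivot i₀) (fun i hi => hw i (Finset.mem_subtype.1 hi))
      (fun i hi j => by
        rw [hpiv, hunit i (Finset.mem_subtype.1 hi)]
        simp [Subtype.ext_iff])
      (fun i hi j hj => hlow i (Finset.mem_subtype.1 hi) j (by simpa using hj))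
      κ (fun x => ⟨f x, hfne x⟩) (fun x y hxy => hf (congrArg Subtype.val hxy))
      (fun i => by simp [Subtype.ext_iff, hR])
    refine ⟨M', h1, ?_, fun b hb => ?_⟩
    · rw [h2]
      ext i j
      exact hpiv _ _
    · rw [← h3 b hb]
      exact det_pivot_eq_zero_iff hα hβ hM (hw i₀ hi₀) (by rw [hone]; exact one_ne_zero)
        hcol hrow' hb

variable [Fintype F]

/-- Once an arbitrary part of the sequence below all weights of some transversal has been fixed,
the determinant still vanishes with probability at least `1 / q`. -/
theorem inv_card_le_exposureProb_det (n : ℕ) : ∀ (k : ℕ) (ι : Type) [Fintype ι] [DecidableEq ι]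
    [Nonempty ι] (_ : Fintype.card ι = n) (M : (ℤ → F) → Matrix ι ι F) (α β : ι → ℤ)
    (_ : Function.Injective α) (_ : Function.Injective β) (_ : IsLeading M α β) (t : ℤ)
    (a : ℤ → F) (_ : ∀ i, t ≤ α i + β i) (_ : ∀ i j, α i + β j < t + k),
    1 / (Fintype.card F : ℚ) ≤ exposureProb (fun b => (M b).det = 0) k t a := by
  induction n using Nat.strong_induction_on with
  | _ n ihn =>
  intro k
  induction k with
  | zero =>
    intro ι _ _ hne _ M α β _ _ _ t a hd hT
    obtain ⟨i⟩ := hne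
    have := hd i
    have := hT i i
    push_cast at this
    omega
  | succ k ihk =>
    intro ι _ _ _ hcard M α β hα hβ hM t a hd hT
    by_cases hnz : ∃ p : ι × ι, α p.1 + β p.2 < t ∧ M a p.1 p.2 ≠ 0
    · obtain ⟨⟨i₀, j₀⟩, hp, hmin⟩ := Finset.exists_min_image
        (Finset.univ.filter fun p : ι × ι => α p.1 + β p.2 < t ∧ M a p.1 p.2 ≠ 0)
        (fun p => α p.1 + β p.2) (by simpa [Finset.Nonempty] using hnz)
      simp only [Finset.mem_filter, Finset.mem_univ, true_and, and_imp, Prod.forall] at hp hmin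
      obtain ⟨hlt, h₀⟩ := hp
      have hne : j₀ ≠ i₀ := by rintro rfl; exact absurd (hd j₀) (by omega)
      have hzero : ∀ i j, α i + β j < α i₀ + β j₀ → M a i j = 0 := fun i j hij => by
        by_contra h
        exact absurd (hmin i j (by omega) h) (by omega)
      set σ : Equiv.Perm ι := Equiv.swap i₀ j₀ with hσ
      have hσ₀ : σ i₀ = j₀ := Equiv.swap_apply_left _ _
      have hβσ : Function.Injective (β ∘ σ) := hβ.comp σ.injective
      rw [exposureProb_congr (k + 1) t a fun b hb => (det_permute_eq_zero_iff (M b) σ).symm.trans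
        (det_pivot_eq_zero_iff hα hβσ (hM.permute σ) (i₀ := i₀) (t := t) (a := a)
          (by simpa [hσ₀] using hlt) (by simpa [hσ₀] using h₀)
          (fun i hi => hzero i _ (by rw [hσ₀]; omega))
          (fun j hj => hzero i₀ _ (by
            simp only [Function.comp_apply, hσ₀] at hj
            omega)) hb)]
      have : Nonempty {i // i ≠ i₀} := ⟨⟨j₀, hne⟩⟩
      refine ihn (Fintype.card {i // i ≠ i₀}) ?_ (k + 1) _ rfl _ _ _
        (hα.comp Subtype.val_injective) (hβσ.comp Subtype.val_injective)
        ((hM.permute σ).pivot i₀) t a ?_ fun i j => hT _ _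
      · rw [← hcard]
        exact Fintype.card_subtype_lt (x := i₀) (by simp)
      · rintro ⟨i, hi⟩
        simp only [Function.comp_apply]
        by_cases hij : i = j₀
        · subst hij
          rw [hσ, Equiv.swap_apply_right]
          have := hd i
          have := hd i₀
          omega
        · rw [hσ, Equiv.swap_apply_of_ne_of_ne hi hij]
          exact hd i
    · push Not at hnz
      have hz : ∀ i j, α i + β j < t → M a i j = 0 := fun i j h => hnz (i, j) h
      obtain ⟨σ, hσ, hcase⟩ := exists_perm_blocked hd
      have hβσ : Function.Injective (β ∘ σ) := hβ.comp σ.injective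
      rw [exposureProb_congr (k + 1) t a fun b _ => (det_permute_eq_zero_iff (M b) σ).symm]
      rcases hcase with hgt | ⟨i₀, hi₀, hblock⟩
      · refine le_exposureProb_succ fun x => ihk ι hcard _ α (β ∘ σ) hα hβσ (hM.permute σ) _ _
          (fun i => hgt i) fun i j => ?_
        have := hT i (σ j)
        push_cast at this
        simp only [Function.comp_apply]
        omega
      · obtain ⟨x, hx⟩ := (hM.permute σ).exists_update_eq_zero a i₀ i₀
        simp only [Function.comp_apply, hi₀] at hx
        refine inv_card_le_exposureProb_succ x (exposureProb_eq_one _ _ _ fun b hb => ?_)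
        refine det_eq_zero_of_blocked hα hβσ (hM.permute σ) (t := t) (fun i j hij => ?_) hi₀
          hblock ((hx x).2 rfl) hb
        rw [(hM.permute σ).eq_of_agree hij fun m hm => Function.update_of_ne hm.ne _ _]
        exact hz _ _ hij

theorem exposureProb_det_pos (n : ℕ) : ∀ (k : ℕ) (ι : Type) [Fintype ι] [DecidableEq ι]
    (_ : Fintype.card ι = n) (M : (ℤ → F) → Matrix ι ι F) (α β : ι → ℤ)
    (_ : Function.Injective α) (_ : Function.Injective β) (_ : IsLeading M α β) (t : ℤ)
    (a : ℤ → F) (_ : ∀ i, t ≤ α i + β i) (_ : ∃ i, t < α i + β i)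
    (_ : ∀ i j, α i ≤ α j ∨ β i ≤ β j) (_ : ∀ i j, α i + β j < t → M a i j = 0)
    (_ : ∀ i j, α i + β j < t + 1 + k),
    0 < exposureProb (fun b => (M b).det = 0) k (t + 1) a := by
  induction n using Nat.strong_induction_on with
  | _ n ihn =>
  intro k ι _ _ hcard M α β hα hβ hM t a hd hgt hanti hz hT
  obtain ⟨i₁, hi₁⟩ := hgt
  by_cases hall : ∀ i, t + 1 ≤ α i + β i
  · have : Nonempty ι := ⟨i₁⟩
    exact lt_of_lt_of_le (by positivity)
      (inv_card_le_exposureProb_det _ k ι hcard M α β hα hβ hM (t + 1) a hall hT)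
  · push Not at hall
    obtain ⟨i₀, hi₀⟩ := hall
    have hi₀ : α i₀ + β i₀ = t := by have := hd i₀; omega
    by_cases h₀ : M a i₀ i₀ = 0
    · rw [exposureProb_eq_one]
      · exact one_pos
      · exact fun b hb =>
          det_eq_zero_of_blocked hα hβ hM hz hi₀ (fun j => hanti j i₀) h₀ hb
    · have hcol : ∀ i, α i < α i₀ → M a i i₀ = 0 := fun i hi => hz _ _ (by omega)
      have hrow : ∀ j, β j < β i₀ → M a i₀ j = 0 := fun j hj => hz _ _ (by omega)
      rw [exposureProb_congr k (t + 1) a fun b hb =>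
        det_pivot_eq_zero_iff hα hβ hM (by omega) h₀ hcol hrow hb]
      refine ihn _ ?_ k _ rfl _ _ _ (hα.comp Subtype.val_injective)
        (hβ.comp Subtype.val_injective) (hM.pivot i₀) t a (fun i => hd i)
        ⟨⟨i₁, by rintro rfl; omega⟩, hi₁⟩ (fun i j => hanti i j) ?_ fun i j => hT i j
      · rw [← hcard]
        exact Fintype.card_subtype_lt (x := i₀) (by simp)
      · intro i j hij
        simp only [Function.comp_apply] at hij
        rw [pivot, Matrix.of_apply, if_neg (by omega)]
        exact hz _ _ hij

theorem inv_card_lt_exposureProb_det_of_later {ι : Type} [Fintype ι] [DecidableEq ι] [Nonempty ι]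
    {M : (ℤ → F) → Matrix ι ι F} {α β : ι → ℤ} (hα : Function.Injective α)
    (hβ : Function.Injective β) (hM : IsLeading M α β) {t : ℤ} {a : ℤ → F} {k : ℕ}
    (hd : ∀ i, t ≤ α i + β i) (hT : ∀ i j, α i + β j < t + k)
    (h : 1 / (Fintype.card F : ℚ) < exposureProb (fun b => (M b).det = 0) k t a) (d : ℕ) :
    1 / (Fintype.card F : ℚ) < exposureProb (fun b => (M b).det = 0) (k + d) (t - d) a := by
  induction d with
  | zero => simpa using h
  | succ d ih =>
    have hs : t - (d + 1 : ℕ) + 1 = t - d := by push_cast; ring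
    refine lt_exposureProb_succ (fun x => ?_) ⟨a (t - (d + 1 : ℕ)), ?_⟩
    · rw [hs]
      refine inv_card_le_exposureProb_det _ (k + d) ι rfl M α β hα hβ hM _ _
        (fun i => by have := hd i; omega) fun i j => ?_
      have := hT i j
      push_cast
      omega
    · rw [Function.update_eq_self, hs]
      exact ih

theorem inv_card_lt_exposureProb_det {ι : Type} [Fintype ι] [DecidableEq ι]
    {M : (ℤ → F) → Matrix ι ι F} {α β : ι → ℤ} (hα : Function.Injective α)
    (hβ : Function.Injective β) (hM : IsLeading M α β) {t : ℤ} {a : ℤ → F} {k : ℕ}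
    (hd : ∀ i, t ≤ α i + β i) (hT : ∀ i j, α i + β j < t + k)
    (hanti : ∀ i j, α i ≤ α j ∨ β i ≤ β j) {i₀ i₁ : ι} (hne : α i₀ + β i₀ ≠ α i₁ + β i₁)
    (ha : M a = 0) :
    1 / (Fintype.card F : ℚ) < exposureProb (fun b => (M b).det = 0) k t a := by
  have : Nonempty ι := ⟨i₀⟩
  obtain ⟨l, -, hl⟩ := Finset.exists_min_image Finset.univ (fun i => α i + β i) ⟨i₀, by simp⟩
  simp only [Finset.mem_univ, true_implies] at hl
  obtain ⟨l', hl'⟩ : ∃ i, α l + β l < α i + β i := by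
    by_contra! h
    exact hne (by linarith [h i₀, h i₁, hl i₀, hl i₁])
  obtain ⟨d, hdt⟩ : ∃ d : ℕ, t = α l + β l - d :=
    ⟨(α l + β l - t).toNat, by have := hd l; omega⟩
  obtain ⟨k, rfl⟩ : ∃ k', k = (k' + 1) + d :=
    ⟨k - (d + 1), by have := hT l l; omega⟩
  rw [hdt]
  have hT' : ∀ i j, α i + β j < α l + β l + (k + 1 : ℕ) := fun i j => by
    have := hT i j; push_cast at this ⊢; omega
  refine inv_card_lt_exposureProb_det_of_later hα hβ hM (fun i => hl i) hT' ?_ d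
  have hz : ∀ y, ∀ i j, α i + β j < α l + β l →
      M (Function.update a (α l + β l) y) i j = 0 := fun y i j hij => by
    rw [hM.eq_of_agree hij (b := a) fun m hm => Function.update_of_ne hm.ne _ _, ha]
    rfl
  obtain ⟨x, hx⟩ := hM.exists_update_eq_zero a l l
  obtain ⟨y, hy⟩ := exists_ne x
  refine inv_card_lt_exposureProb_succ hy.symm (exposureProb_eq_one _ _ _ fun b hb => ?_) ?_
  · exact det_eq_zero_of_blocked hα hβ hM (hz x) rfl (fun j => hanti j l) ((hx x).2 rfl) hb
  · refine exposureProb_det_pos _ k ι rfl M α β hα hβ hM _ _ hl ⟨l', hl'⟩ hanti (hz y) ?_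
    intro i j
    have := hT' i j
    push_cast at this
    omega

/-- The case of constant diagonal weights: one more pivot in the bottom left corner makes the
diagonal weights unequal. -/
theorem inv_card_lt_exposureProb_det_of_rank_one {d : ℕ}
    {M : (ℤ → F) → Matrix (Fin (d + 1)) (Fin (d + 1)) F} {α β : Fin (d + 1) → ℤ}
    (hα : StrictAnti α) (hβ : StrictMono β) (hM : IsLeading M α β) {t s : ℤ} {a : ℤ → F} {k : ℕ}
    (hd : ∀ i, α i + β i = t) (hT : ∀ i j, α i + β j < s + k)
    (hs : s ≤ α (Fin.last d) + β 0)
    (h₀ : M a (Fin.last d) 0 ≠ 0)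
    (hrank : ∀ i j, M a i j * M a (Fin.last d) 0 = M a i 0 * M a (Fin.last d) j)
    {i j : Fin d} (hij : α i.castSucc + β i.succ ≠ α j.castSucc + β j.succ) :
    1 / (Fintype.card F : ℚ) < exposureProb (fun b => (M b).det = 0) k s a := by
  set w := α (Fin.last d) + β 0 with hw
  have hd0 : 0 < d := i.pos
  have hwt : w < t := by
    rw [← hd 0, hw]
    have := hα (show (0 : Fin (d + 1)) < Fin.last d from Fin.lt_def.2 (by simpa using hd0))
    omega
  obtain ⟨e, he⟩ : ∃ e : ℕ, s = w + 1 - e := ⟨(w + 1 - s).toNat, by omega⟩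
  obtain ⟨k, rfl⟩ : ∃ k', k = k' + e := ⟨k - e, by
    have := hT (Fin.last d) 0; omega⟩
  have hT' : ∀ i j, α i + β j < w + 1 + k := fun i j => by
    have := hT i j; push_cast at this; omega
  rw [he]
  refine inv_card_lt_exposureProb_det_of_later hα.injective hβ.injective hM
    (fun i => by rw [hd]; omega) hT' ?_ e
  set σ := finRotate (d + 1) with hσ
  have hσl : σ (Fin.last d) = 0 := finRotate_last
  have hσc : ∀ l : Fin d, σ l.castSucc = l.succ := fun l => by
    rw [hσ, finRotate_apply, Fin.coeSucc_eq_succ]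
  have hβσ : Function.Injective (β ∘ σ) := hβ.injective.comp σ.injective
  have hcol : ∀ i, α i < α (Fin.last d) → (M a).submatrix id σ i (Fin.last d) = 0 :=
    fun i hi => absurd (hα.antitone (Fin.le_last i)) (by omega)
  have hrow : ∀ j, (β ∘ σ) j < (β ∘ σ) (Fin.last d) →
      (M a).submatrix id σ (Fin.last d) j = 0 := fun j hj => by
    rw [Function.comp_apply, Function.comp_apply, hσl] at hj
    exact absurd (hβ.monotone (Fin.zero_le (σ j))) (by omega)
  rw [exposureProb_congr k (w + 1) a fun b hb => (det_permute_eq_zero_iff (M b) σ).symm.trans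
    (det_pivot_eq_zero_iff hα.injective hβσ (hM.permute σ) (i₀ := Fin.last d) (t := w + 1)
      (a := a) (by simp [hσl, hw]) (by simpa [hσl] using h₀) hcol hrow hb)]
  have hcast : ∀ x : {i : Fin (d + 1) // i ≠ Fin.last d}, ∃ l : Fin d, x = l.castSucc :=
    fun x => ⟨(x : Fin (d + 1)).castPred x.2, by simp⟩
  refine inv_card_lt_exposureProb_det (hα.injective.comp Subtype.val_injective)
    (hβσ.comp Subtype.val_injective) ((hM.permute σ).pivot _) (fun x => ?_) (fun x y => hT' _ _)
    (fun x y => ?_) (i₀ := ⟨i.castSucc, (Fin.castSucc_lt_last i).ne⟩)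
    (i₁ := ⟨j.castSucc, (Fin.castSucc_lt_last j).ne⟩) ?_ ?_
  · obtain ⟨l, hl⟩ := hcast x
    simp only [Function.comp_apply, hl, hσc]
    have h1 := hd l.castSucc
    have h2 := hβ (Fin.castSucc_lt_succ (i := l))
    omega
  · obtain ⟨l, hl⟩ := hcast x
    obtain ⟨l', hl'⟩ := hcast y
    simp only [Function.comp_apply, hl, hl', hσc, hα.le_iff_ge, hβ.le_iff_le,
      Fin.castSucc_le_castSucc_iff, Fin.succ_le_succ_iff]
    exact le_total _ _
  · simpa only [Function.comp_apply, hσc] using hij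
  · ext x y
    rw [pivot_apply hα.injective hβσ hcol hrow]
    simp only [Matrix.submatrix_apply, id, hσl, Matrix.zero_apply]
    rw [sub_eq_zero, eq_div_iff h₀, hrank]

end Bounds

section JacobiTrudi

variable {F : Type*} [Field F]

/-- Extension of a sequence by zero to the negative integers. -/
def seqExt (h : ℕ → F) (m : ℤ) : F := if 0 ≤ m then h m.toNat else 0

theorem exists_conv_inverse {h : ℕ → F} (h0 : h 0 = 1) :
    ∃ u : ℕ → F, u 0 = 1 ∧
      (∀ m : ℕ, ∑ k ∈ range (m + 1), h k * u (m - k) = if m = 0 then 1 else 0) ∧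
      ∀ m : ℕ, ∑ k ∈ range (m + 1), u k * h (m - k) = if m = 0 then 1 else 0 := by
  have hne : PowerSeries.constantCoeff (PowerSeries.mk h) ≠ 0 := by simp [h0]
  have h1 := PowerSeries.mul_inv_cancel (PowerSeries.mk h) hne
  have h2 := PowerSeries.inv_mul_cancel (PowerSeries.mk h) hne
  refine ⟨fun k => PowerSeries.coeff k (PowerSeries.mk h)⁻¹, ?_, fun m => ?_, fun m => ?_⟩
  · simp [h0]
  · have := congrArg (PowerSeries.coeff m) h1
    rw [PowerSeries.coeff_mul, Finset.Nat.sum_antidiagonal_eq_sum_range_succ_mk,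
      PowerSeries.coeff_one] at this
    simpa using this
  · have := congrArg (PowerSeries.coeff m) h2
    rw [PowerSeries.coeff_mul, Finset.Nat.sum_antidiagonal_eq_sum_range_succ_mk,
      PowerSeries.coeff_one] at this
    simpa using this

theorem sum_mul_seqExt {h u : ℕ → F}
    (hu : ∀ m : ℕ, ∑ k ∈ range (m + 1), u k * h (m - k) = if m = 0 then 1 else 0)
    {m : ℤ} {J : ℕ} (hJ : m ≤ J) :
    ∑ k ∈ range (J + 1), u k * seqExt h (m - k) = if m = 0 then 1 else 0 := by
  rcases lt_or_ge m 0 with hm | hm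
  · rw [if_neg hm.ne]
    exact Finset.sum_eq_zero fun k _ => by rw [seqExt, if_neg (by omega), mul_zero]
  · lift m to ℕ using hm
    have hm := hu m
    simp only [Nat.cast_eq_zero]
    rw [← hm, ← Finset.sum_subset (Finset.range_subset_range.2 (show m + 1 ≤ J + 1 by omega))]
    · refine Finset.sum_congr rfl fun k hk => ?_
      have hk : k ≤ m := by simpa [Nat.lt_succ_iff] using hk
      rw [seqExt, if_pos (by omega), show ((m : ℤ) - k).toNat = m - k by omega]
    · intro k _ hk
      have hk : m < k := by simpa [Nat.lt_succ_iff] using hk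
      rw [seqExt, if_neg (by omega), mul_zero]

/-- The Jacobi–Trudi matrix times the unitriangular Toeplitz matrix with entries `u`. -/
def jtConv (n : ℕ) (lam : ℕ → ℕ) (u : ℕ → F) (b : ℤ → F) : Matrix (Fin n) (Fin n) F :=
  Matrix.of fun i j => ∑ k ∈ range ((j : ℕ) + 1), u k * b ((lam i : ℤ) - i + j - k)

theorem isLeading_jtConv (n : ℕ) (lam : ℕ → ℕ) {u : ℕ → F} (hu : u 0 = 1) :
    IsLeading (jtConv n lam u) (fun i => (lam i : ℤ) - i) (fun j => (j : ℤ)) := by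
  intro i j a b hab
  simp only [jtConv, Matrix.of_apply, Finset.sum_range_succ', hu, one_mul, Nat.cast_zero, sub_zero,
    add_sub_cancel_right]
  exact Finset.sum_congr rfl fun k _ => by rw [hab _ (by push_cast; omega)]

theorem det_jtConv (n : ℕ) (lam : ℕ → ℕ) {u : ℕ → F} (hu : u 0 = 1) (b : ℤ → F) :
    (jtConv n lam u b).det =
      (Matrix.of fun i j : Fin n => b ((lam i : ℤ) - i + j)).det := by
  have hU : (Matrix.of fun j' j : Fin n =>
      if (j' : ℕ) ≤ j then u ((j : ℕ) - j') else 0).det = 1 := by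
    rw [Matrix.det_of_isUpperTriangular]
    · simp [hu]
    · intro i j hij
      have : ¬ i ≤ j := not_le.2 hij
      simp [this]
  rw [← mul_one (Matrix.det (Matrix.of fun i j : Fin n => b ((lam i : ℤ) - i + j))), ← hU,
    ← Matrix.det_mul]
  congr 1
  ext i j
  simp only [jtConv, Matrix.mul_apply, Matrix.of_apply]
  rw [Fin.sum_univ_eq_sum_range (fun m : ℕ => b ((lam i : ℤ) - i + m) *
    if m ≤ (j : ℕ) then u ((j : ℕ) - m) else 0) n,
    ← Finset.sum_subset (Finset.range_subset_range.2 (show (j : ℕ) + 1 ≤ n from j.2)),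
    ← Finset.sum_range_reflect]
  · refine Finset.sum_congr rfl fun k hk => ?_
    have hk : k ≤ j := by simpa [Nat.lt_succ_iff] using hk
    rw [if_pos (by omega), mul_comm]
    congr 2
    omega
  · intro m _ hm
    rw [if_neg (by simpa [Nat.lt_succ_iff] using hm), mul_zero]

theorem probEq_eq_exposureProb [Fintype F] {n : ℕ} {lam : ℕ → ℕ} (hlam : ∀ i < n, lam i ≤ lam 0)
    {h : ℕ → F} (h0 : h 0 = 1) {u : ℕ → F} (hu : u 0 = 1) :
    probEq F n lam (lam 0 + (n - 1)) 0 =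
      exposureProb (fun b => (jtConv n lam u b).det = 0) (lam 0 + (n - 1)) 1 (seqExt h) := by
  rw [exposureProb_eq_card_div, probEq]
  congr 2
  refine congrArg _ (Finset.filter_congr fun b _ => ?_)
  rw [det_jtConv n lam hu]
  suffices JTmat F n lam (extFin b) = Matrix.of fun i j : Fin n =>
      (fun m : ℤ => if hm : 1 ≤ m ∧ m < 1 + (lam 0 + (n - 1) : ℕ) then
        b ⟨(m - 1).toNat, by omega⟩ else seqExt h m) ((lam i : ℤ) - i + j) by
    rw [this]
  ext i j
  have := hlam i i.2
  simp only [JTmat, extFin, seqExt, Matrix.of_apply]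
  generalize hm : (lam i : ℤ) - i + j = m
  by_cases h1 : 1 ≤ m
  · rw [if_pos h1, dif_pos (by omega), dif_pos (by omega)]
    congr 2
    omega
  · rw [if_neg h1, dif_neg (by omega)]
    by_cases h2 : m = 0
    · simp [h2, h0]
    · rw [if_neg h2, if_neg (by omega)]

theorem exists_column_order {n D : ℕ} {lam : ℕ → ℕ} (hDn : D ≤ n)
    (hD : ∀ i < n, i < D ↔ i < lam i) (hlam : ∀ i j, i ≤ j → j < n → lam j ≤ lam i) :
    ∃ σ : Equiv.Perm (Fin n), StrictMono (fun l : Fin D => σ (l.castLE hDn)) ∧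
      ∀ i : Fin n, D ≤ i → (σ i : ℕ) = i - lam i := by
  set p : {i : Fin n // D ≤ i} → Fin n := fun i => ⟨i - lam i, by omega⟩ with hp
  have hpinj : Function.Injective p := by
    rintro ⟨i, hi⟩ ⟨j, hj⟩ hij
    have hij : (i : ℕ) - lam i = j - lam j := congrArg Fin.val hij
    have h1 := (hD i i.2).not.1 (by omega)
    have h2 := (hD j j.2).not.1 (by omega)
    ext
    rcases le_total (i : ℕ) j with h | h
    · have := hlam i j h j.2
      dsimp only
      omega
    · have := hlam j i h i.2
      dsimp only
      omega
  set S : Finset (Fin n) := (Finset.univ.map ⟨p, hpinj⟩)ᶜ with hS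
  have hcard : S.card = D := by
    have : Fintype.card {i : Fin n // D ≤ i} = n - D := by
      rw [← Fintype.card_fin (n - D)]
      exact Fintype.card_congr ⟨fun i => ⟨i.1 - D, by omega⟩,
        fun l => ⟨⟨l + D, by omega⟩, by simp⟩, fun i => by ext; simp; omega, fun l => by simp⟩
    rw [hS, Finset.card_compl, Finset.card_map, Finset.card_univ, this, Fintype.card_fin]
    omega
  set e := S.orderEmbOfFin hcard with he
  have hep : ∀ l i, e l ≠ p i := fun l i hli => by
    have := S.orderEmbOfFin_mem hcard l
    rw [← he, hli, hS] at this
    simp at this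
  set g : Fin n → Fin n := fun i => if hi : (i : ℕ) < D then e ⟨i, hi⟩ else p ⟨i, by omega⟩ with hg
  have hginj : Function.Injective g := by
    intro i j hij
    simp only [hg] at hij
    split_ifs at hij with h1 h2 h2
    · exact Fin.ext (Fin.mk.inj_iff.1 (e.injective hij))
    · exact absurd hij (hep _ _)
    · exact absurd hij.symm (hep _ _)
    · exact congrArg Subtype.val (hpinj hij)
  refine ⟨Equiv.ofBijective g (Finite.injective_iff_bijective.1 hginj), fun l m hlm => ?_,
    fun i hi => ?_⟩
  · simpa [hg] using hlm
  · simp [hg, hp, hi.not_gt]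

theorem exists_reduced_jacobiTrudi [Fintype F] {n D : ℕ} {lam : ℕ → ℕ} (hDn : D ≤ n)
    (hD : ∀ i < n, i < D ↔ i < lam i) (hlam : ∀ i j, i ≤ j → j < n → lam j ≤ lam i)
    {σ : Equiv.Perm (Fin n)} (hσ : ∀ i : Fin n, D ≤ i → (σ i : ℕ) = i - lam i)
    {h u : ℕ → F} (h0 : h 0 = 1) (hu0 : u 0 = 1)
    (hu : ∀ m : ℕ, ∑ k ∈ range (m + 1), u k * h (m - k) = if m = 0 then 1 else 0) :
    ∃ M : (ℤ → F) → Matrix (Fin D) (Fin D) F,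
      IsLeading M (fun l => (lam l : ℤ) - l) (fun l => ((σ (l.castLE hDn) : ℕ) : ℤ)) ∧
      (∀ l m, M (seqExt h) l m = ∑ k ∈ range ((σ (m.castLE hDn) : ℕ) + 1),
        u k * seqExt h ((lam l : ℤ) - l + (σ (m.castLE hDn) : ℕ) - k)) ∧
      exposureProb (fun b => (M b).det = 0) (lam 0 + (n - 1)) 1 (seqExt h) =
        probEq F n lam (lam 0 + (n - 1)) 0 := by
  have hα : Function.Injective fun i : Fin n => (lam i : ℤ) - i := by
    intro i j hij
    dsimp only at hij
    ext
    rcases le_total (i : ℕ) j with h | h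
    · have := hlam i j h j.2
      omega
    · have := hlam j i h i.2
      omega
  have hβ : Function.Injective ((fun j : Fin n => ((j : ℕ) : ℤ)) ∘ σ) :=
    (Nat.cast_injective.comp Fin.val_injective).comp σ.injective
  have hle : ∀ i : Fin n, D ≤ i → lam i ≤ i := fun i hi =>
    not_lt.1 ((hD i i.2).not.1 hi.not_gt)
  have hw : ∀ i ∈ Finset.univ.filter fun i : Fin n => D ≤ i,
      (lam i : ℤ) - i + ((fun j : Fin n => ((j : ℕ) : ℤ)) ∘ σ) i < 1 := fun i hi => by
    have hi : D ≤ i := by simpa using hi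
    have := hle i hi
    simp only [Function.comp_apply, hσ i hi]
    omega
  have hunit : ∀ i ∈ Finset.univ.filter fun i : Fin n => D ≤ i, ∀ j,
      (jtConv n lam u (seqExt h)).submatrix id σ i j = if j = i then 1 else 0 := fun i hi j => by
    have hi : D ≤ i := by simpa using hi
    have := hle i hi
    simp only [Matrix.submatrix_apply, id, jtConv, Matrix.of_apply]
    rw [sum_mul_seqExt hu (by omega)]
    refine if_congr ?_ rfl rfl
    rw [← σ.injective.eq_iff, Fin.ext_iff, hσ i hi]
    omega
  have hlow : ∀ i ∈ Finset.univ.filter fun i : Fin n => D ≤ i,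
      ∀ j ∉ Finset.univ.filter fun i : Fin n => D ≤ i,
      (lam i : ℤ) - i < (lam j : ℤ) - j := fun i hi j hj => by
    have hi : D ≤ i := by simpa using hi
    have hj : (j : ℕ) < D := by simpa using hj
    have := hle i hi
    have := (hD j j.2).1 hj
    omega
  have hrange : ∀ i, (i ∉ Finset.univ.filter fun i : Fin n => D ≤ i) ↔
      ∃ x, Fin.castLE hDn x = i := fun i => by
    simp only [Finset.mem_filter, Finset.mem_univ, true_and, not_le]
    exact ⟨fun hi => ⟨⟨i, hi⟩, rfl⟩, by rintro ⟨x, rfl⟩; exact x.2⟩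
  obtain ⟨M, h1, h2, h3⟩ := exists_eliminated (t := 1) (a := seqExt h) _ (Fin n) _ rfl _ _ _ hα hβ
    ((isLeading_jtConv n lam hu0).permute σ) hw hunit hlow (Fin D) (Fin.castLE hDn)
    (Fin.castLE_injective hDn) hrange
  refine ⟨M, h1, fun l m => ?_, ?_⟩
  · rw [h2]
    rfl
  · rw [probEq_eq_exposureProb (fun i hi => hlam 0 i (Nat.zero_le _) hi) h0 hu0]
    exact exposureProb_congr _ _ _ fun b hb =>
      (h3 b hb).symm.trans (det_permute_eq_zero_iff _ σ)

theorem strictAnti_sub_of_antitone {n D : ℕ} {lam : ℕ → ℕ} (hDn : D ≤ n)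
    (hlam : ∀ i j, i ≤ j → j < n → lam j ≤ lam i) :
    StrictAnti fun l : Fin D => (lam l : ℤ) - l := fun l m hlm => by
  have hlm : (l : ℕ) < m := hlm
  have := hlam l m hlm.le (by omega)
  dsimp only
  omega

theorem diag_weight_eq [Fintype F] {n D : ℕ} {lam : ℕ → ℕ} (hDn : D ≤ n)
    (hD : ∀ i < n, i < D ↔ i < lam i) (hlam : ∀ i j, i ≤ j → j < n → lam j ≤ lam i)
    {σ : Equiv.Perm (Fin n)} (hmono : StrictMono (fun l : Fin D => σ (l.castLE hDn)))
    (hσ : ∀ i : Fin n, D ≤ i → (σ i : ℕ) = i - lam i)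
    (hprob : probEq F n lam (lam 0 + (n - 1)) 0 = 1 / (Fintype.card F : ℚ)) (l m : Fin D) :
    (lam l : ℤ) - l + (σ (l.castLE hDn) : ℕ) = (lam m : ℤ) - m + (σ (m.castLE hDn) : ℕ) := by
  by_contra hne
  obtain ⟨M, hM, hval, hexp⟩ := exists_reduced_jacobiTrudi (F := F) hDn hD hlam hσ
    (h := fun k => if k = 0 then 1 else 0) (u := fun k => if k = 0 then 1 else 0) (by simp)
    (by simp) fun m => by rw [Finset.sum_range_succ', Finset.sum_eq_zero] <;> simp
  have hα := strictAnti_sub_of_antitone hDn hlam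
  have hpos : ∀ l : Fin D, (l : ℤ) < lam l := fun l => by
    exact_mod_cast (hD l (by omega)).1 l.2
  refine (inv_card_lt_exposureProb_det hα.injective
    (fun i j hij => hmono.injective (Fin.ext (by exact_mod_cast hij))) hM
    (t := 1) (a := seqExt fun k => if k = 0 then 1 else 0) (k := lam 0 + (n - 1)) (fun i => ?_)
    (fun i j => ?_) (fun i j => ?_) hne ?_).ne' (hexp.trans hprob)
  · have := hpos i
    omega
  · have := hlam 0 i (Nat.zero_le _) (by omega)
    push_cast
    omega
  · rcases le_total i j with hij | hij
    · exact Or.inr (by exact_mod_cast hmono.monotone hij)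
    · exact Or.inl (hα.antitone hij)
  · ext i j
    have := hpos i
    rw [hval, Matrix.zero_apply]
    refine Finset.sum_eq_zero fun k hk => ?_
    by_cases hk0 : k = 0
    · subst hk0
      refine mul_eq_zero_of_right _ ?_
      simp only [seqExt]
      rw [if_pos (by omega), if_neg (by omega)]
    · simp [hk0]

theorem exists_seq_row (c : ℕ) : ∃ h u : ℕ → F, h 0 = 1 ∧ u 0 = 1 ∧
    (∀ m : ℕ, ∑ k ∈ range (m + 1), u k * h (m - k) = if m = 0 then 1 else 0) ∧
    (∀ k, c ≤ k → h k = 1) ∧ ∀ k, 1 ≤ k → k < c → u k = 0 := by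
  obtain ⟨u, hu0, hhu, huh⟩ := exists_conv_inverse
    (h := fun k => if k = 0 ∨ c ≤ k then (1 : F) else 0) (by simp)
  refine ⟨fun k => if k = 0 ∨ c ≤ k then 1 else 0, u, by simp, hu0, huh,
    fun k hk => by simp [hk], fun k hk hkc => ?_⟩
  have := (hhu k).trans (if_neg (by omega))
  rw [Finset.sum_range_succ', Finset.sum_eq_zero] at this
  · simpa using this
  · intro i hi
    have hi : i < k := by simpa using hi
    rw [if_neg (by omega), zero_mul]

theorem exists_seq_column (γ : ℕ) (hγ : 1 ≤ γ) : ∃ h u : ℕ → F, h 0 = 1 ∧ u 0 = 1 ∧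
    (∀ m : ℕ, ∑ k ∈ range (m + 1), u k * h (m - k) = if m = 0 then 1 else 0) ∧
    (∀ k, k ≤ γ → h k = 1) ∧ u (γ + 1) = 1 ∧ ∀ k, γ + 1 < k → u k = 0 := by
  obtain ⟨h, h0, huh, -⟩ := exists_conv_inverse
    (h := fun k => if k = 0 then (1 : F) else if k = 1 then -1 else if k = γ + 1 then 1 else 0)
    (by simp)
  refine ⟨h, _, h0, by simp, huh, fun k hk => ?_, ?_, fun k hk => ?_⟩
  · induction k with
    | zero => exact h0
    | succ k ih =>
      have := huh (k + 1)
      rw [Finset.sum_range_succ', Finset.sum_range_succ', Finset.sum_eq_zero,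
        if_neg k.succ_ne_zero] at this
      · simp only [zero_add, one_ne_zero, if_true, if_false, Nat.add_sub_cancel, Nat.sub_zero,
          ih (by omega)] at this
        linear_combination this
      · intro i hi
        have hi : i < k := by simpa using hi
        rw [if_neg (by omega), if_neg (by omega), if_neg (by omega), zero_mul]
  · simp; omega
  · rw [if_neg (by omega), if_neg (by omega), if_neg (by omega)]

theorem sum_mul_seqExt_of_support {h u : ℕ → F}
    (hu : ∀ m : ℕ, ∑ k ∈ range (m + 1), u k * h (m - k) = if m = 0 then 1 else 0)
    {B : ℕ} (hB : ∀ k, B < k → u k = 0) {m : ℤ} (hm : m ≠ 0) :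
    ∑ k ∈ range (B + 1), u k * seqExt h (m - k) = 0 := by
  have := sum_mul_seqExt hu (m := m) (J := max B m.toNat) (by omega)
  rw [if_neg hm] at this
  rw [← this]
  refine Finset.sum_subset (Finset.range_subset_range.2 (by omega)) fun k _ hk => ?_
  rw [hB k (by simpa [Nat.lt_succ_iff] using hk), zero_mul]

/-- A choice of sequence for which the reduced Jacobi–Trudi matrix has rank one, with nonzero
bottom left corner. -/
theorem exists_seq_rank_one {d : ℕ} {α : Fin (d + 1) → ℤ} {β : Fin (d + 1) → ℕ}
    (hα : StrictAnti α) (hβ : StrictMono β) (hpos : 1 ≤ α (Fin.last d)) :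
    ∃ h u : ℕ → F, h 0 = 1 ∧ u 0 = 1 ∧
      (∀ m : ℕ, ∑ k ∈ range (m + 1), u k * h (m - k) = if m = 0 then 1 else 0) ∧
      ∀ A : Matrix (Fin (d + 1)) (Fin (d + 1)) F,
        (∀ l m, A l m = ∑ k ∈ range (β m + 1), u k * seqExt h (α l + β m - k)) →
        A (Fin.last d) 0 ≠ 0 ∧
          ∀ i j, A i j * A (Fin.last d) 0 = A i 0 * A (Fin.last d) j := by
  have hmin : ∀ i, α (Fin.last d) ≤ α i := fun i => hα.antitone (Fin.le_last i)
  rcases lt_or_ge (β 0 : ℤ) (α (Fin.last d)) with hlt | hge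
  · obtain ⟨h, u, h0, hu0, huh, hh, hu⟩ := exists_seq_row (F := F) (α (Fin.last d)).toNat
    refine ⟨h, u, h0, hu0, huh, fun A hA => ?_⟩
    have hA' : ∀ l m, A l m = ∑ k ∈ range (β m + 1), u k := fun l m => by
      rw [hA]
      refine Finset.sum_congr rfl fun k hk => ?_
      have hk : k ≤ β m := by simpa [Nat.lt_succ_iff] using hk
      have := hmin l
      rw [seqExt, if_pos (by omega), hh _ (by omega), mul_one]
    refine ⟨?_, fun i j => by rw [hA', hA', hA', hA', mul_comm]⟩
    rw [hA', Finset.sum_range_succ', Finset.sum_eq_zero, hu0]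
    · simp
    · intro k hk
      have hk : k < β 0 := by simpa using hk
      exact hu _ (by omega) (by omega)
  · obtain ⟨h, u, h0, hu0, huh, hh, hu1, hu⟩ := exists_seq_column (F := F) (β 0) (by omega)
    refine ⟨h, u, h0, hu0, huh, fun A hA => ?_⟩
    have hA' : ∀ l m, m ≠ 0 → A l m = 0 := fun l m hm => by
      have hm : β 0 < β m := hβ (Fin.pos_iff_ne_zero.2 hm)
      have := hmin l
      rw [hA]
      exact sum_mul_seqExt_of_support huh (fun k hk => hu k (by omega)) (by omega)
    refine ⟨?_, fun i j => ?_⟩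
    · have := sum_mul_seqExt_of_support huh hu (m := α (Fin.last d) + β 0) (by omega)
      rw [Finset.sum_range_succ, ← hA, hu1, one_mul, seqExt, if_pos (by push_cast; omega),
        hh _ (by push_cast; omega)] at this
      rw [eq_neg_of_add_eq_zero_left this]
      simp
    · by_cases hj : j = 0
      · rw [hj]
      · rw [hA' _ _ hj, hA' _ _ hj, zero_mul, mul_zero]

theorem step_weight_eq [Fintype F] {n d : ℕ} {lam : ℕ → ℕ} (hDn : d + 1 ≤ n)
    (hD : ∀ i < n, i < d + 1 ↔ i < lam i) (hlam : ∀ i j, i ≤ j → j < n → lam j ≤ lam i)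
    {σ : Equiv.Perm (Fin n)} (hmono : StrictMono (fun l : Fin (d + 1) => σ (l.castLE hDn)))
    (hσ : ∀ i : Fin n, d + 1 ≤ i → (σ i : ℕ) = i - lam i)
    (hprob : probEq F n lam (lam 0 + (n - 1)) 0 = 1 / (Fintype.card F : ℚ)) (i j : Fin d) :
    lam i - lam (i + 1) = lam j - lam (j + 1) := by
  have hα := strictAnti_sub_of_antitone hDn hlam
  have hpos : (d : ℤ) < lam d := by exact_mod_cast (hD d (by omega)).1 (by omega)
  have hdiag := diag_weight_eq hDn hD hlam hmono hσ hprob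
  by_contra hne
  have hβ : StrictMono fun l : Fin (d + 1) => (σ (l.castLE hDn) : ℕ) := fun l m h => hmono h
  obtain ⟨h, u, h0, hu0, huh, hA⟩ := exists_seq_rank_one (F := F) hα hβ
    (by rw [Fin.val_last]; omega)
  obtain ⟨M, hM, hval, hexp⟩ := exists_reduced_jacobiTrudi (F := F) hDn hD hlam hσ h0 hu0 huh
  obtain ⟨hcorner, hrank⟩ := hA _ hval
  refine (inv_card_lt_exposureProb_det_of_rank_one (s := 1) (k := lam 0 + (n - 1)) hα
    (fun l m h => by exact_mod_cast hβ h) hM (fun l => hdiag l 0) (fun l m => ?_) ?_ hcorner hrank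
    (i := i) (j := j) ?_).ne' (hexp.trans hprob)
  · have := hlam 0 l (Nat.zero_le _) (by omega)
    push_cast
    omega
  · rw [Fin.val_last]
    omega
  · have h1 := hdiag i.succ j.succ
    have h3 := hlam i (i + 1) (by omega) (by omega)
    have h4 := hlam j (j + 1) (by omega) (by omega)
    simp only [Fin.val_castSucc, Fin.val_succ] at h1 ⊢
    push_cast at h1
    omega

end JacobiTrudi

/-- If `λ` has `n` parts, smallest part `λ_n ≥ 2`, and `P(s_λ ↦ 0) = 1/q`, then `λ`
has at most two distinct part sizes: `λ = (λ_1^m, λ_n^{n−m})` for some `1 ≤ m ≤ n`. -/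
theorem prob_eq_inv_q_two_part_sizes (F : Type*) [Field F] [Fintype F]
    (n : ℕ) (hn : 0 < n) (lam : ℕ → ℕ) (hpart : IsPartition n lam)
    (hmin : 2 ≤ lam (n - 1))
    (hprob : probEq F n lam (lam 0 + (n - 1)) 0 = 1 / (Fintype.card F : ℚ)) :
    ∃ m, 1 ≤ m ∧ m ≤ n ∧ (∀ i, i < m → lam i = lam 0) ∧
      ∀ i, m ≤ i → i < n → lam i = lam (n - 1) := by
  have hlam : ∀ i j, i ≤ j → j < n → lam j ≤ lam i := fun i j hij => by
    induction j, hij using Nat.le_induction with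
    | base => exact fun _ => le_rfl
    | succ j _ ih => exact fun hj => (hpart.1 j hj).trans (ih (by omega))
  have htwo : ∀ i < n, 2 ≤ lam i := fun i hi => hmin.trans (hlam i (n - 1) (by omega) (by omega))
  obtain rfl | hn1 := eq_or_ne n 1
  · exact ⟨1, le_rfl, le_rfl, fun i hi => by rw [Nat.lt_one_iff.1 hi], fun i _ _ => by omega⟩
  obtain ⟨D, hDn, hD⟩ : ∃ D ≤ n, ∀ i < n, i < D ↔ i < lam i := by
    have hex : ∃ m, m = n ∨ lam m ≤ m := ⟨n, Or.inl rfl⟩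
    refine ⟨Nat.find hex, Nat.find_min' hex (Or.inl rfl), fun i hi => ⟨fun h => ?_, fun h => ?_⟩⟩
    · have := Nat.find_min hex h
      push Not at this
      exact this.2
    · by_contra! hle
      rcases Nat.find_spec hex with h1 | h1
      · omega
      · have := hlam _ i hle hi
        omega
  have hD2 : 2 ≤ D := (hD 1 (by omega)).2 (htwo 1 (by omega))
  obtain ⟨e, rfl⟩ : ∃ e, D = e + 1 + 1 := ⟨D - 2, by omega⟩
  obtain ⟨σ, hmono, hσ⟩ := exists_column_order hDn hD hlam
  have hdiag := diag_weight_eq hDn hD hlam hmono hσ hprob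
  have hstep := step_weight_eq hDn hD hlam hmono hσ hprob
  have hβ : StrictMono fun l : Fin (e + 1 + 1) => (σ (l.castLE hDn) : ℕ) := fun l m h => hmono h
  -- a column that is not eliminated
  have hcol : ∀ c : Fin n, (∀ i : Fin n, e + 1 + 1 ≤ i → (i : ℕ) - lam i ≠ c) →
      ∃ l : Fin (e + 1 + 1), (σ (l.castLE hDn) : ℕ) = c := fun c hc => by
    refine ⟨⟨σ.symm c, ?_⟩, ?_⟩
    · by_contra! h
      exact hc _ h (by rw [← hσ _ h, Equiv.apply_symm_apply])
    · exact congrArg Fin.val (σ.apply_symm_apply c)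
  have hlast : (σ ((Fin.last (e + 1)).castLE hDn) : ℕ) = n - 1 := by
    obtain ⟨l, hl⟩ := hcol ⟨n - 1, by omega⟩ fun i hi => by
      have := htwo i i.2
      dsimp only
      omega
    have := hβ.monotone (Fin.le_last l)
    dsimp only at this hl
    omega
  have hprev : (σ ((Fin.last e).castSucc.castLE hDn) : ℕ) = n - 2 := by
    obtain ⟨l, hl⟩ := hcol ⟨n - 2, by omega⟩ fun i hi => by
      have := htwo i i.2
      dsimp only
      omega
    have hne : l ≠ Fin.last (e + 1) := by
      rintro rfl
      dsimp only at hl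
      omega
    have h1 := hβ.monotone (show l ≤ (Fin.last e).castSucc by
      have := Fin.lt_last_iff_ne_last.2 hne
      rw [Fin.lt_def] at this
      rw [Fin.le_def]
      simp at this ⊢
      omega)
    have h2 := hβ (Fin.castSucc_lt_last (Fin.last e))
    dsimp only at h1 h2 hl
    omega
  have heq : ∀ i < e + 1, lam (i + 1) = lam i := fun i hi => by
    have h1 := hstep ⟨i, hi⟩ (Fin.last e)
    have h2 := hdiag (Fin.last e).castSucc (Fin.last (e + 1))
    have h3 := hlam i (i + 1) (by omega) (by omega)
    rw [hlast, hprev] at h2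
    simp only [Fin.val_castSucc, Fin.val_last] at h1 h2
    omega
  have hconst : ∀ i < e + 1 + 1, lam i = lam 0 := fun i => by
    induction i with
    | zero => exact fun _ => rfl
    | succ i ih => exact fun hi => (heq i (by omega)).trans (ih (by omega))
  refine ⟨e + 1 + 1, by omega, hDn, hconst, fun i hi hin => ?_⟩
  have hbot : e + 1 + 1 ≤ lam (n - 1) := by
    by_contra! hlt
    have hle := (hD (n - 1) (by omega)).not.1 (by omega)
    set l : Fin (e + 1 + 1) := ⟨e + 1 - lam (n - 1), by omega⟩ with hl
    have h1 := hdiag l (Fin.last (e + 1))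
    rw [hlast, hconst l l.2, hconst (Fin.last (e + 1)) (Fin.last (e + 1)).2] at h1
    have h2 := hσ ⟨n - 1, by omega⟩ (by dsimp only; omega)
    have h3 : l.castLE hDn = ⟨n - 1, by omega⟩ := σ.injective (Fin.ext (by
      rw [h2]
      simp only [hl, Fin.val_last] at h1 ⊢
      omega))
    have := congrArg Fin.val h3
    simp only [hl, Fin.val_castLE] at this
    omega
  have h1 := (hD (e + 1 + 1) (by omega)).not.1 (by omega)
  have h2 := hlam (e + 1 + 1) i hi hin
  have h3 := hlam i (n - 1) (by omega) (by omega)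
  omega
end

section
/- Let λ = (a^p, b^m) be a fattened hook with p, m ≥ 1 and a > b ≥ 2 (i.e. p parts equal to a followed by m parts equal to b). Then P(s_λ ↦ 0) > 1/q. -/
open Finset Classical

section Determinants

variable {F : Type*} [Field F]

/-- A matrix with a zero block of size `r × s`, `r + s > n`, is singular. -/
lemma det_eq_zero_of_zero_block_s13 {n : ℕ} (M : Matrix (Fin n) (Fin n) F) (S C : Finset (Fin n))
    (h : ∀ i ∈ S, ∀ j ∈ C, M i j = 0) (hc : n < S.card + C.card) : M.det = 0 := by
  rw [Matrix.det_apply]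
  refine Finset.sum_eq_zero fun σ _ => ?_
  have : ∃ j ∈ C, σ j ∈ S := by
    by_contra! hne
    have hd : Disjoint S (C.map σ.toEmbedding) := by
      rw [Finset.disjoint_left]
      intro i hi hi'
      obtain ⟨j, hj, rfl⟩ := Finset.mem_map.1 hi'
      exact hne j hj hi
    have := Finset.card_le_univ (S ∪ C.map σ.toEmbedding)
    rw [Finset.card_union_of_disjoint hd, Finset.card_map, Fintype.card_fin] at this
    omega
  obtain ⟨j, hj, hjS⟩ := this
  have hprod : ∏ i, M (σ i) i = 0 := Finset.prod_eq_zero (Finset.mem_univ j) (h _ hjS _ hj)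
  rw [hprod, smul_zero]

/-- A matrix which is triangular after a suitable ordering of its rows and columns, with nonzero
pivots, is invertible. -/
lemma det_ne_zero_of_pivots {n : ℕ} (M : Matrix (Fin n) (Fin n) F) (σ : Fin n → Fin n)
    (f : Fin n → ℕ) (hp : ∀ j, M (σ j) j ≠ 0)
    (ht : ∀ j j', j' ≠ j → M (σ j) j' ≠ 0 → f j' < f j) : M.det ≠ 0 := by
  intro h0
  obtain ⟨v, hv, hMv⟩ := Matrix.exists_mulVec_eq_zero_iff.2 h0
  apply hv
  have key : ∀ d j, f j = d → v j = 0 := by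
    intro d
    induction d using Nat.strong_induction_on with
    | _ d ih =>
      intro j hj
      have h1 := congrFun hMv (σ j)
      rw [Matrix.mulVec, dotProduct, Finset.sum_eq_single j] at h1
      · exact (mul_eq_zero.1 h1).resolve_left (hp j)
      · intro j' _ hne
        by_cases hz : M (σ j) j' = 0
        · rw [hz, zero_mul]
        · rw [ih (f j') (hj ▸ ht j j' hne hz) j' rfl, mul_zero]
      · simp
  funext j
  exact key _ j rfl

/-- The Schur complement of a single entry. -/
def schurEntry {n : ℕ} (M : Matrix (Fin (n + 1)) (Fin (n + 1)) F) (r c : Fin (n + 1)) :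
    Matrix (Fin n) (Fin n) F :=
  Matrix.of fun i j => M (r.succAbove i) (c.succAbove j) -
    M (r.succAbove i) c * M r (c.succAbove j) / M r c

lemma det_eq_zero_iff_schurEntry {n : ℕ} (M : Matrix (Fin (n + 1)) (Fin (n + 1)) F)
    (r c : Fin (n + 1)) (h : M r c ≠ 0) : M.det = 0 ↔ (schurEntry M r c).det = 0 := by
  let A : Matrix (Fin (n + 1)) (Fin (n + 1)) F :=
    Matrix.of fun i j => M i j + (if i = r then 0 else -(M i c / M r c)) * M r j
  have hdet : A.det = M.det :=
    Matrix.det_eq_of_forall_row_eq_smul_add_const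
      (fun i => if i = r then 0 else -(M i c / M r c)) r (by simp) (fun i j => rfl)
  have hsub : A.submatrix r.succAbove c.succAbove = schurEntry M r c := by
    ext i j
    simp only [A, schurEntry, Matrix.submatrix_apply, Matrix.of_apply, Fin.succAbove_ne,
      if_false]
    ring
  rw [← hdet, Matrix.det_succ_column A c, Finset.sum_eq_single r, hsub]
  · simp [A, h]
  · intro i _ hi
    have : A i c = 0 := by
      simp only [A, Matrix.of_apply, hi, if_false]
      field_simp
      ring
    simp [this]
  · simp

end Determinants

section Counting

variable {F : Type*} [Fintype F] {N : ℕ}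

/-- The tuples which agree with `z` on the first `t` coordinates. -/
noncomputable def cylinder (z : Fin N → F) (t : ℕ) : Finset (Fin N → F) :=
  Finset.univ.filter fun x => ∀ s : Fin N, (s : ℕ) < t → x s = z s

lemma mem_cylinder {z : Fin N → F} {t : ℕ} {x : Fin N → F} :
    x ∈ cylinder z t ↔ ∀ s : Fin N, (s : ℕ) < t → x s = z s := by
  simp [cylinder]

lemma self_mem_cylinder (z : Fin N → F) (t : ℕ) : z ∈ cylinder z t :=
  mem_cylinder.2 fun _ _ => rfl

lemma mem_cylinder_update {z : Fin N → F} {t : ℕ} (ht : t < N) {c : F} {x : Fin N → F} :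
    x ∈ cylinder (Function.update z ⟨t, ht⟩ c) (t + 1) ↔ x ∈ cylinder z t ∧ x ⟨t, ht⟩ = c := by
  simp only [mem_cylinder]
  constructor
  · intro h
    refine ⟨fun s hs => ?_, ?_⟩
    · rw [h s (by omega), Function.update_of_ne]
      intro he
      rw [he] at hs
      exact lt_irrefl _ hs
    · rw [h ⟨t, ht⟩ (Nat.lt_succ_self t), Function.update_self]
  · rintro ⟨h, hc⟩ s hs
    by_cases he : s = ⟨t, ht⟩
    · rw [he, hc, Function.update_self]
    · rw [Function.update_of_ne he]
      refine h s ?_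
      have : (s : ℕ) ≠ t := fun h' => he (Fin.ext h')
      omega

lemma card_filter_cylinder (z : Fin N → F) {t : ℕ} (ht : t < N) (P : (Fin N → F) → Prop) :
    ((cylinder z t).filter P).card =
      ∑ c : F, ((cylinder (Function.update z ⟨t, ht⟩ c) (t + 1)).filter P).card := by
  rw [Finset.card_eq_sum_card_fiberwise (f := fun x => x ⟨t, ht⟩) (t := Finset.univ)
    (fun _ _ => Finset.mem_coe.2 (Finset.mem_univ _))]
  refine Finset.sum_congr rfl fun c _ => congrArg Finset.card ?_
  ext x
  simp only [Finset.mem_filter, mem_cylinder_update]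
  tauto

lemma card_cylinder (z : Fin N → F) (t : ℕ) :
    (cylinder z t).card = Fintype.card F ^ (N - t) := by
  induction h : N - t generalizing t z with
  | zero =>
    rw [pow_zero, Finset.card_eq_one]
    refine ⟨z, Finset.eq_singleton_iff_unique_mem.2 ⟨self_mem_cylinder z t, fun x hx => ?_⟩⟩
    funext s
    exact mem_cylinder.1 hx s (by omega)
  | succ d ih =>
    have ht : t < N := by omega
    have := card_filter_cylinder z ht (fun _ => True)
    simp only [Finset.filter_true] at this
    rw [this, Finset.sum_congr rfl fun c _ => ih (Function.update z ⟨t, ht⟩ c) (t + 1) (by omega),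
      Finset.sum_const, Finset.card_univ, smul_eq_mul, pow_succ']

end Counting

section Reveal

variable {F : Type*} [Field F] [Fintype F] {N : ℕ}

/-- A matrix `E x` depending on `x : Fin N → F`, whose `(i, j)` entry is the variable with label
`L i j` up to a function of the variables with smaller label, once the first `t` variables are
fixed to agree with `z`. Labels at most `t` mark entries which are already determined; none of them
lies on or above the diagonal. -/
structure IsLabelled {n : ℕ} (z : Fin N → F) (t : ℕ) (L : Fin n → Fin n → ℤ)
    (E : (Fin N → F) → Matrix (Fin n) (Fin n) F) : Prop where
  row_mono : ∀ i, StrictMono (L i)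
  col_anti : ∀ j, StrictAnti fun i => L i j
  diag : ∀ i, (t : ℤ) < L i i
  le : ∀ i j, L i j ≤ N
  sub_eq : ∀ i j, ∀ x ∈ cylinder z t, ∀ y ∈ cylinder z t,
    (∀ s : Fin N, (s : ℤ) + 1 < L i j → x s = y s) →
      E x i j - E y i j = extFin x (L i j).toNat - extFin y (L i j).toNat

lemma extFin_congr {G : Type*} [Zero G] {x y : Fin N → G} {l : ℤ}
    (h : ∀ s : Fin N, (s : ℤ) + 1 ≤ l → x s = y s) :
    extFin x l.toNat = extFin y l.toNat := by
  unfold extFin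
  split_ifs with hl
  · exact h _ (by simp only; omega)
  · rfl

namespace IsLabelled

variable {n : ℕ} {z : Fin N → F} {t : ℕ} {L : Fin n → Fin n → ℤ}
  {E : (Fin N → F) → Matrix (Fin n) (Fin n) F}

lemma entry_congr (hE : IsLabelled z t L E) {i j : Fin n} {x y : Fin N → F}
    (hx : x ∈ cylinder z t) (hy : y ∈ cylinder z t)
    (h : ∀ s : Fin N, (s : ℤ) + 1 ≤ L i j → x s = y s) : E x i j = E y i j := by
  have h1 := hE.sub_eq i j x hx y hy fun s hs => h s hs.le
  rw [extFin_congr h, sub_self] at h1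
  exact sub_eq_zero.1 h1

lemma entry_eq_of_le (hE : IsLabelled z t L E) {i j : Fin n} (hl : L i j ≤ t) {x y : Fin N → F}
    (hx : x ∈ cylinder z t) (hy : y ∈ cylinder z t) : E x i j = E y i j :=
  hE.entry_congr hx hy fun s hs => by
    rw [mem_cylinder.1 hx s (by omega), mem_cylinder.1 hy s (by omega)]

lemma lt_of_le (hE : IsLabelled z t L E) {i j : Fin n} (hl : L i j ≤ t) : j < i := by
  by_contra! hij
  have h1 := (hE.row_mono i).monotone hij
  have h2 := hE.diag i
  omega

lemma update (hE : IsLabelled z t L E) (ht : t < N) (c : F)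
    (hd : ∀ i, L i i ≠ (t : ℤ) + 1) :
    IsLabelled (Function.update z ⟨t, ht⟩ c) (t + 1) L E where
  row_mono := hE.row_mono
  col_anti := hE.col_anti
  diag i := by
    have h1 := hE.diag i
    have h2 := hd i
    push_cast
    omega
  le := hE.le
  sub_eq i j x hx y hy h :=
    hE.sub_eq i j x ((mem_cylinder_update ht).1 hx).1 y ((mem_cylinder_update ht).1 hy).1 h

end IsLabelled

/-- `(r, c)` is a nonzero determined entry, with only zeros among the determined entries in the
columns to its left, and only zeros below it. -/
structure IsPivot {n : ℕ} (z : Fin N → F) (t : ℕ) (L : Fin n → Fin n → ℤ)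
    (E : (Fin N → F) → Matrix (Fin n) (Fin n) F) (r c : Fin n) : Prop where
  le : L r c ≤ t
  ne_zero : E z r c ≠ 0
  left : ∀ i, ∀ j < c, L i j ≤ t → E z i j = 0
  below : ∀ i, r < i → E z i c = 0

lemma exists_isPivot {n : ℕ} {z : Fin N → F} {t : ℕ} {L : Fin n → Fin n → ℤ}
    {E : (Fin N → F) → Matrix (Fin n) (Fin n) F} (hE : IsLabelled z t L E)
    (h : ∃ i j, L i j ≤ t ∧ E z i j ≠ 0) : ∃ r c, IsPivot z t L E r c := by
  obtain ⟨i, j, h1, h2⟩ := h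
  obtain ⟨c, ⟨i', hc1, hc2⟩, hcmin⟩ :=
    WellFounded.has_min (wellFounded_lt (α := Fin n)) {j | ∃ i, L i j ≤ t ∧ E z i j ≠ 0}
      ⟨j, i, h1, h2⟩
  obtain ⟨r, ⟨hr1, hr2⟩, hrmax⟩ :=
    WellFounded.has_min (wellFounded_gt (α := Fin n)) {i | L i c ≤ t ∧ E z i c ≠ 0} ⟨i', hc1, hc2⟩
  refine ⟨r, c, hr1, hr2, fun i j hj hl => ?_, fun i hi => ?_⟩
  · by_contra hne
    exact hcmin j ⟨i, hl, hne⟩ hj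
  · by_contra hne
    exact hrmax i ⟨((hE.col_anti c).antitone hi.le).trans hr1, hne⟩ hi

namespace IsPivot

variable {n : ℕ} {z : Fin N → F} {t : ℕ} {L : Fin (n + 1) → Fin (n + 1) → ℤ}
  {E : (Fin N → F) → Matrix (Fin (n + 1)) (Fin (n + 1)) F} {r c : Fin (n + 1)}

lemma entry_eq (hP : IsPivot z t L E r c) (hE : IsLabelled z t L E) {x : Fin N → F}
    (hx : x ∈ cylinder z t) : E x r c = E z r c :=
  hE.entry_eq_of_le hP.le hx (self_mem_cylinder z t)

/-- If `A` has the same determined entries as `E w`, for some time `τ ≥ t`, then eliminating with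
the pivot `(r, c)` preserves this. -/
lemma correction_congr (hP : IsPivot z t L E r c) (hE : IsLabelled z t L E)
    {w : Fin N → F} (hw : w ∈ cylinder z t) {A : Matrix (Fin (n + 1)) (Fin (n + 1)) F}
    {i j : Fin (n + 1)} (hi : i ≠ r) (hj : j ≠ c)
    (hA : ∀ i' j', L i' j' ≤ t ∨ L i' j' < L i j → A i' j' = E w i' j') :
    A i c * A r j / A r c = E w i c * E w r j / E w r c := by
  rcases lt_or_gt_of_ne hi with hi | hi
  · rcases lt_or_gt_of_ne hj with hj | hj
    · have hl : L r j ≤ t := ((hE.row_mono r) hj).le.trans hP.le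
      have h0 : E w r j = 0 := by
        rw [hE.entry_eq_of_le hl hw (self_mem_cylinder z t)]
        exact hP.left r j hj hl
      rw [hA r j (Or.inl hl), h0]
      simp
    · rw [hA i c (Or.inr (hE.row_mono i hj)), hA r j (Or.inr (hE.col_anti j hi)),
        hA r c (Or.inl hP.le)]
  · have hl : L i c ≤ t := (hE.col_anti c hi).le.trans hP.le
    have h0 : E w i c = 0 := by
      rw [hE.entry_eq_of_le hl hw (self_mem_cylinder z t)]
      exact hP.below i hi
    rw [hA i c (Or.inl hl), h0]
    simp

lemma diag_le (hP : IsPivot z t L E r c) (hE : IsLabelled z t L E) (i : Fin n) :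
    r.succAbove i ≤ c.succAbove i := by
  have hlt : c < r := hE.lt_of_le hP.le
  rw [Fin.le_def]
  rw [Fin.lt_def] at hlt
  simp only [Fin.succAbove, Fin.lt_def, Fin.val_castSucc]
  split_ifs <;> simp <;> omega

lemma isLabelled_schurEntry (hP : IsPivot z t L E r c) (hE : IsLabelled z t L E) :
    IsLabelled z t (fun i j => L (r.succAbove i) (c.succAbove j))
      (fun x => schurEntry (E x) r c) where
  row_mono i := (hE.row_mono _).comp (Fin.strictMono_succAbove c)
  col_anti j := (hE.col_anti _).comp_strictMono (Fin.strictMono_succAbove r)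
  diag i := (hE.diag (r.succAbove i)).trans_le ((hE.row_mono _).monotone (hP.diag_le hE i))
  le i j := hE.le _ _
  sub_eq i j x hx y hy h := by
    have hc := hP.correction_congr hE hy (A := E x) (Fin.succAbove_ne r i) (Fin.succAbove_ne c j)
      (by
        rintro i' j' (hl | hl)
        · exact hE.entry_eq_of_le hl hx hy
        · exact hE.entry_congr hx hy fun s hs => h s (hs.trans_lt hl))
    simp only [schurEntry, Matrix.of_apply]
    rw [hc, ← hE.sub_eq _ _ x hx y hy h]
    ring

lemma det_eq_zero_iff (hP : IsPivot z t L E r c) (hE : IsLabelled z t L E) {x : Fin N → F}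
    (hx : x ∈ cylinder z t) : (E x).det = 0 ↔ (schurEntry (E x) r c).det = 0 :=
  det_eq_zero_iff_schurEntry _ _ _ (by rw [hP.entry_eq hE hx]; exact hP.ne_zero)

end IsPivot

/-- The tuples agreeing with `z` on the first `t` coordinates for which `E` is singular. -/
noncomputable def singularSet {n : ℕ} (z : Fin N → F) (t : ℕ)
    (E : (Fin N → F) → Matrix (Fin n) (Fin n) F) : Finset (Fin N → F) :=
  (cylinder z t).filter fun x => (E x).det = 0

/-- A certificate that the singular tuples of `E` have proportion greater than `1 / q`. -/
structure IsExcessWitness {n : ℕ} (z : Fin N → F) (t : ℕ) (L : Fin n → Fin n → ℤ)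
    (E : (Fin N → F) → Matrix (Fin n) (Fin n) F) (τ : Fin N) (w w' : Fin N → F)
    (A : Matrix (Fin n) (Fin n) F) : Prop where
  le : t ≤ τ
  mem : w ∈ cylinder z t
  mem' : w' ∈ cylinder w τ
  ne : w' τ ≠ w τ
  det_ne_zero : A.det ≠ 0
  entry_eq : ∀ i j, L i j ≤ τ → A i j = E w i j
  det_eq_zero : ∀ x ∈ cylinder w (τ + 1), (E x).det = 0
  det_eq_zero' : (E w').det = 0

lemma cylinder_subset {G : Type*} [Fintype G] {z w : Fin N → G} {t τ : ℕ} (h : t ≤ τ)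
    (hw : w ∈ cylinder z t) :
    cylinder w τ ⊆ cylinder z t := fun x hx => mem_cylinder.2 fun s hs => by
  rw [mem_cylinder.1 hx s (by omega), mem_cylinder.1 hw s hs]

namespace IsExcessWitness

lemma schurEntry {n : ℕ} {z : Fin N → F} {t : ℕ} {L : Fin (n + 1) → Fin (n + 1) → ℤ}
    {E : (Fin N → F) → Matrix (Fin (n + 1)) (Fin (n + 1)) F} {r c : Fin (n + 1)}
    {τ : Fin N} {w w' : Fin N → F} {A : Matrix (Fin (n + 1)) (Fin (n + 1)) F}
    (hW : IsExcessWitness z t L E τ w w' A) (hP : IsPivot z t L E r c) (hE : IsLabelled z t L E) :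
    IsExcessWitness z t (fun i j => L (r.succAbove i) (c.succAbove j))
      (fun x => schurEntry (E x) r c) τ w w' (schurEntry A r c) where
  le := hW.le
  mem := hW.mem
  mem' := hW.mem'
  ne := hW.ne
  det_ne_zero h := by
    refine hW.det_ne_zero ((det_eq_zero_iff_schurEntry _ r c ?_).2 h)
    rw [hW.entry_eq r c (hP.le.trans (by exact_mod_cast hW.le)), hP.entry_eq hE hW.mem]
    exact hP.ne_zero
  entry_eq i j hl := by
    have hle : (t : ℤ) ≤ (τ : ℕ) := by exact_mod_cast hW.le
    simp only [_root_.schurEntry, Matrix.of_apply]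
    rw [hW.entry_eq _ _ hl, hP.correction_congr hE hW.mem (Fin.succAbove_ne r i)
      (Fin.succAbove_ne c j)]
    rintro i' j' (h | h)
    · exact hW.entry_eq _ _ (h.trans hle)
    · exact hW.entry_eq _ _ (h.le.trans hl)
  det_eq_zero x hx := by
    have hx' : x ∈ cylinder z t := cylinder_subset (by have := hW.le; omega) hW.mem hx
    exact (hP.det_eq_zero_iff hE hx').1 (hW.det_eq_zero x hx)
  det_eq_zero' :=
    (hP.det_eq_zero_iff hE (cylinder_subset hW.le hW.mem hW.mem')).1 hW.det_eq_zero'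

end IsExcessWitness

section Induction

variable {n : ℕ} {z : Fin N → F} {t : ℕ} {L : Fin n → Fin n → ℤ}
  {E : (Fin N → F) → Matrix (Fin n) (Fin n) F}

/-- At least a proportion `1 / q` of the tuples in the cylinder is singular, and more than that if
there is a witness. -/
def HasManySingular (z : Fin N → F) (t : ℕ) (L : Fin n → Fin n → ℤ)
    (E : (Fin N → F) → Matrix (Fin n) (Fin n) F) : Prop :=
  (cylinder z t).card ≤ Fintype.card F * (singularSet z t E).card ∧
    ∀ τ w w' A, IsExcessWitness z t L E τ w w' A →
      (cylinder z t).card < Fintype.card F * (singularSet z t E).card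

lemma IsPivot.hasManySingular {L : Fin (n + 1) → Fin (n + 1) → ℤ}
    {E : (Fin N → F) → Matrix (Fin (n + 1)) (Fin (n + 1)) F} {r c : Fin (n + 1)}
    (hP : IsPivot z t L E r c) (hE : IsLabelled z t L E)
    (h : HasManySingular z t (fun i j => L (r.succAbove i) (c.succAbove j))
      (fun x => schurEntry (E x) r c)) : HasManySingular z t L E := by
  have heq : singularSet z t E = singularSet z t (fun x => schurEntry (E x) r c) :=
    Finset.filter_congr fun x hx => hP.det_eq_zero_iff hE hx
  unfold HasManySingular
  rw [heq]
  exact ⟨h.1, fun τ w w' A hW => h.2 τ w w' _ (hW.schurEntry hP hE)⟩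

lemma singularSet_eq_cylinder {t : ℕ} (h : ∀ x ∈ cylinder z t, (E x).det = 0) :
    singularSet z t E = cylinder z t :=
  Finset.filter_true_of_mem h

lemma card_singularSet (ht : t < N) : (singularSet z t E).card =
    ∑ c : F, (singularSet (Function.update z ⟨t, ht⟩ c) (t + 1) E).card :=
  card_filter_cylinder z ht _

lemma hasManySingular_of_update (ht : t < N)
    (h : ∀ c, HasManySingular (Function.update z ⟨t, ht⟩ c) (t + 1) L E) :
    HasManySingular z t L E := by
  have hcyl := card_filter_cylinder z ht (fun _ => True)
  simp only [Finset.filter_true] at hcyl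
  unfold HasManySingular
  rw [card_singularSet ht, hcyl, Finset.mul_sum]
  refine ⟨Finset.sum_le_sum fun c _ => (h c).1, fun τ w w' A hW => ?_⟩
  refine Finset.sum_lt_sum (fun c _ => (h c).1) ⟨w ⟨t, ht⟩, Finset.mem_univ _, ?_⟩
  rcases hW.le.lt_or_eq with hlt | heq
  · refine (h _).2 τ w w' A ⟨hlt, ?_, hW.mem', hW.ne, hW.det_ne_zero, hW.entry_eq, hW.det_eq_zero,
      hW.det_eq_zero'⟩
    exact (mem_cylinder_update ht).2 ⟨hW.mem, rfl⟩
  · rw [singularSet_eq_cylinder, card_cylinder]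
    · exact lt_mul_of_one_lt_left (Nat.pow_pos Fintype.card_pos) Fintype.one_lt_card
    · intro x hx
      refine hW.det_eq_zero x (mem_cylinder.2 fun s hs => ?_)
      rw [mem_cylinder_update] at hx
      by_cases hst : (s : ℕ) < t
      · rw [mem_cylinder.1 hx.1 s hst, mem_cylinder.1 hW.mem s hst]
      · have : s = ⟨t, ht⟩ := Fin.ext (by simp only; omega)
        rw [this, hx.2]

lemma hasManySingular_of_diag (hE : IsLabelled z t L E) (hz : ∀ i j, L i j ≤ t → E z i j = 0)
    (ht : t < N) {i : Fin n} (hi : L i i = (t : ℤ) + 1) : HasManySingular z t L E := by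
  have hlt : ∀ r s, i ≤ r → s ≤ i → (r ≠ i ∨ s ≠ i) → L r s ≤ t := by
    intro r s hr hs hne
    have h1 : L r s ≤ L i s := (hE.col_anti s).antitone hr
    have h2 : L i s ≤ L i i := (hE.row_mono i).monotone hs
    rcases hne with hne | hne
    · have h3 : L r s < L i s := hE.col_anti s (lt_of_le_of_ne hr hne.symm)
      omega
    · have h3 : L i s < L i i := hE.row_mono i (lt_of_le_of_ne hs hne)
      omega
  have hblock : ∀ B : Matrix (Fin n) (Fin n) F, B i i = 0 →
      (∀ r s, L r s ≤ t → B r s = 0) → B.det = 0 := by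
    intro B hB hB'
    refine det_eq_zero_of_zero_block_s13 B (Finset.Ici i) (Finset.Iic i) (fun r hr s hs => ?_) ?_
    · by_cases hrs : r = i ∧ s = i
      · rw [hrs.1, hrs.2, hB]
      · exact hB' r s (hlt r s (Finset.mem_Ici.1 hr) (Finset.mem_Iic.1 hs) (by tauto))
    · rw [Fin.card_Ici, Fin.card_Iic]
      omega
  set c₀ : F := z ⟨t, ht⟩ - E z i i with hc₀
  have hentry : ∀ x ∈ cylinder z t, E x i i = E z i i + (x ⟨t, ht⟩ - z ⟨t, ht⟩) := by
    intro x hx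
    have h1 := hE.sub_eq i i x hx z (self_mem_cylinder z t)
      fun s hs => mem_cylinder.1 hx s (by omega)
    have h2 : ∀ y : Fin N → F, extFin y (L i i).toNat = y ⟨t, ht⟩ := by
      intro y
      have h3 : (L i i).toNat = t + 1 := by omega
      have h4 : 1 ≤ t + 1 ∧ t + 1 ≤ N := by omega
      rw [h3, extFin, dif_pos h4]
      rfl
    rw [h2, h2] at h1
    linear_combination h1
  have hzero : ∀ x ∈ cylinder z t, x ⟨t, ht⟩ = c₀ → (E x).det = 0 := by
    intro x hx hxc
    refine hblock _ ?_ fun r s h => ?_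
    · rw [hentry x hx, hxc, hc₀]
      ring
    · rw [hE.entry_eq_of_le h hx (self_mem_cylinder z t), hz r s h]
  have hsub : cylinder (Function.update z ⟨t, ht⟩ c₀) (t + 1) ⊆ singularSet z t E := by
    intro x hx
    rw [mem_cylinder_update] at hx
    exact Finset.mem_filter.2 ⟨hx.1, hzero x hx.1 hx.2⟩
  have hcard : (cylinder z t).card =
      Fintype.card F * (cylinder (Function.update z ⟨t, ht⟩ c₀) (t + 1)).card := by
    rw [card_cylinder, card_cylinder, ← pow_succ']
    congr 1
    omega
  refine ⟨?_, fun τ w w' A hW => ?_⟩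
  · rw [hcard]
    exact Nat.mul_le_mul_left _ (Finset.card_le_card hsub)
  · rw [hcard]
    refine Nat.mul_lt_mul_of_pos_left (Finset.card_lt_card ?_) Fintype.card_pos
    have hstrict : ∀ x ∈ singularSet z t E, x ⟨t, ht⟩ ≠ c₀ →
        cylinder (Function.update z ⟨t, ht⟩ c₀) (t + 1) ⊂ singularSet z t E := by
      intro x hx hne
      refine (Finset.ssubset_iff_of_subset hsub).2 ⟨x, hx, fun h => hne ?_⟩
      exact ((mem_cylinder_update ht).1 h).2
    by_cases hw : w ⟨t, ht⟩ = c₀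
    · rcases hW.le.lt_or_eq with hτ | hτ
      · exfalso
        have hτ' : (t : ℤ) < (τ : ℕ) := by exact_mod_cast hτ
        refine hW.det_ne_zero (hblock A ?_ fun r s h => ?_)
        · rw [hW.entry_eq i i (by omega), hentry w hW.mem, hw, hc₀]
          ring
        · rw [hW.entry_eq r s (h.trans hτ'.le),
            hE.entry_eq_of_le h hW.mem (self_mem_cylinder z t), hz r s h]
      · have hτ' : τ = ⟨t, ht⟩ := Fin.ext hτ.symm
        refine hstrict w' (Finset.mem_filter.2
          ⟨cylinder_subset hW.le hW.mem hW.mem', hW.det_eq_zero'⟩) ?_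
        rw [← hw, ← hτ']
        exact hW.ne
    · exact hstrict w (Finset.mem_filter.2
        ⟨hW.mem, hW.det_eq_zero w (self_mem_cylinder w _)⟩) hw

theorem IsLabelled.hasManySingular (hE : IsLabelled z t L E) (hn : 0 < n) :
    HasManySingular z t L E := by
  induction hd : N - t + n using Nat.strong_induction_on generalizing n z t with
  | _ d ih =>
    by_cases hz : ∃ i j, L i j ≤ t ∧ E z i j ≠ 0
    · obtain ⟨r, c, hP⟩ := exists_isPivot hE hz
      obtain ⟨n, rfl⟩ := Nat.exists_eq_succ_of_ne_zero hn.ne'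
      have hlt : c < r := hE.lt_of_le hP.le
      have h0 : 0 < n := by
        rw [Fin.lt_def] at hlt
        omega
      exact hP.hasManySingular hE (ih _ (by omega) (hP.isLabelled_schurEntry hE) h0 rfl)
    · push Not at hz
      have h1 := hE.diag ⟨0, hn⟩
      have h2 := hE.le ⟨0, hn⟩ ⟨0, hn⟩
      have ht : t < N := by omega
      by_cases hdiag : ∃ i, L i i = (t : ℤ) + 1
      · obtain ⟨i, hi⟩ := hdiag
        exact hasManySingular_of_diag hE hz ht hi
      · push Not at hdiag
        exact hasManySingular_of_update ht fun c =>
          ih _ (by omega) (hE.update ht c hdiag) hn rfl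

end Induction

end Reveal

section JacobiTrudi

variable {F : Type*} [Field F]

/-- The value of `h_l` for an arbitrary integer subscript `l`. -/
def hValue (x : ℕ → F) (l : ℤ) : F :=
  if 1 ≤ l then x l.toNat else if l = 0 then 1 else 0

lemma JTmat_apply (k : ℕ) (lam : ℕ → ℕ) (x : ℕ → F) (i j : Fin k) :
    JTmat F k lam x i j = hValue x ((lam i : ℤ) - (i : ℤ) + (j : ℤ)) := rfl

lemma hValue_congr {x y : ℕ → F} {l : ℤ} (h : ∀ n : ℕ, 1 ≤ n → (n : ℤ) ≤ l → x n = y n) :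
    hValue x l = hValue y l := by
  unfold hValue
  split_ifs with h1 h2
  · exact h _ (by omega) (by omega)
  · rfl
  · rfl

lemma hValue_indicator (P : ℤ → Prop) [DecidablePred P] (l : ℤ) :
    hValue (fun n => if P n then (1 : F) else 0) l = if l = 0 ∨ (1 ≤ l ∧ P l) then 1 else 0 := by
  unfold hValue
  by_cases h1 : 1 ≤ l
  · have h2 : l ≠ 0 := by omega
    have h3 : ((l.toNat : ℕ) : ℤ) = l := by omega
    simp [h1, h2, h3]
  · simp [h1]

lemma hValue_zero (l : ℤ) : hValue (fun _ => (0 : F)) l = if l = 0 then 1 else 0 := by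
  simpa using hValue_indicator (F := F) (fun _ => False) l

lemma IsPartition.le_of_le {k : ℕ} {lam : ℕ → ℕ} (h : IsPartition k lam) {i j : ℕ} (hij : i ≤ j)
    (hj : j < k) : lam j ≤ lam i := by
  induction j, hij using Nat.le_induction with
  | base => exact le_rfl
  | succ j _ ih => exact (h.1 j hj).trans (ih (by omega))

lemma isLabelled_JTmat [Fintype F] {k N : ℕ} {lam : ℕ → ℕ} (h : IsPartition k lam)
    (hN : lam 0 + (k - 1) ≤ N) (z : Fin N → F) :
    IsLabelled z 0 (fun i j : Fin k => (lam i : ℤ) - (i : ℤ) + (j : ℤ))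
      (fun x => JTmat F k lam (extFin x)) where
  row_mono i j j' hj := by
    rw [Fin.lt_def] at hj
    simp only
    omega
  col_anti j i i' hi := by
    have := h.le_of_le hi.le i'.2
    rw [Fin.lt_def] at hi
    simp only
    omega
  diag i := by
    have := h.2 i i.2
    omega
  le i j := by
    have := h.le_of_le (Nat.zero_le i) i.2
    have := i.2
    have := j.2
    omega
  sub_eq i j x _ y _ _ := by
    simp only [JTmat_apply, hValue]
    split_ifs with h1 h2
    · rfl
    all_goals
      have h3 : ((lam i : ℤ) - (i : ℤ) + (j : ℤ)).toNat = 0 := by omega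
      simp [h3, extFin]

/-- A criterion for a Jacobi–Trudi determinant to vanish with probability exceeding `1 / q`:
after `h_1, …, h_(τ-1)` have been fixed, some completion of the known entries is invertible,
some value of `h_τ` forces the determinant to vanish, and some other value allows it. -/
theorem one_div_card_lt_probEq [Fintype F] {k N : ℕ} {lam : ℕ → ℕ} (h : IsPartition k lam)
    (hk : 0 < k) (hN : lam 0 + (k - 1) ≤ N) (g g' : ℕ → F) (τ : ℕ) (hτ : 1 ≤ τ) (hτN : τ ≤ N)
    (hgg' : ∀ n, 1 ≤ n → n < τ → g' n = g n) (hne : g' τ ≠ g τ)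
    (A : Matrix (Fin k) (Fin k) F) (hA : A.det ≠ 0)
    (hAg : ∀ i j : Fin k, (lam i : ℤ) - (i : ℤ) + (j : ℤ) < τ → A i j = JTmat F k lam g i j)
    (hg : ∀ x : ℕ → F, (∀ n, 1 ≤ n → n ≤ τ → x n = g n) → (JTmat F k lam x).det = 0)
    (hg' : (JTmat F k lam g').det = 0) :
    1 / (Fintype.card F : ℚ) < probEq F k lam N 0 := by
  have hext : ∀ (y : ℕ → F) (n : ℕ), 1 ≤ n → n ≤ N →
      extFin (fun s : Fin N => y (s + 1)) n = y n := by
    intro y n h1 h2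
    rw [extFin, dif_pos ⟨h1, h2⟩]
    simp only
    congr 1
    omega
  have hlab := isLabelled_JTmat h hN (0 : Fin N → F)
  have hJT : ∀ (y : ℕ → F), JTmat F k lam (extFin fun s : Fin N => y (s + 1)) =
      JTmat F k lam y := by
    intro y
    ext i j
    rw [JTmat_apply, JTmat_apply]
    have h2 := hlab.le i j
    exact hValue_congr fun n hn hn' => hext y n hn (by omega)
  have hW : IsExcessWitness (0 : Fin N → F) 0
      (fun i j : Fin k => (lam i : ℤ) - (i : ℤ) + (j : ℤ)) (fun x => JTmat F k lam (extFin x))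
      ⟨τ - 1, by omega⟩ (fun s => g (s + 1)) (fun s => g' (s + 1)) A := by
    refine ⟨Nat.zero_le _, mem_cylinder.2 fun s hs => absurd hs (Nat.not_lt_zero _),
      mem_cylinder.2 fun s hs => hgg' _ (by omega) ?_, ?_, hA, fun i j hl => ?_, fun x hx => ?_, ?_⟩
    · simp only at hs
      omega
    · simp only
      rw [Nat.sub_add_cancel hτ]
      exact hne
    · simp only at hl ⊢
      rw [hJT, hAg i j (by omega)]
    · refine hg _ fun n h1 h2 => ?_
      rw [extFin, dif_pos ⟨h1, h2.trans hτN⟩, mem_cylinder.1 hx _ (by simp only; omega)]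
      simp only
      rw [Nat.sub_add_cancel h1]
    · simp only [hJT, hg']
  have hlt := (hlab.hasManySingular hk).2 _ _ _ _ hW
  have hc0 : cylinder (0 : Fin N → F) 0 = Finset.univ :=
    Finset.filter_true_of_mem fun x _ s hs => absurd hs (Nat.not_lt_zero _)
  rw [card_cylinder, singularSet, hc0, Nat.sub_zero] at hlt
  have hq : (0 : ℚ) < Fintype.card F := by exact_mod_cast Fintype.card_pos
  rw [probEq, div_lt_div_iff₀ hq (pow_pos hq N), one_mul, mul_comm]
  exact_mod_cast hlt

lemma det_eq_zero_of_row_eq_add {n : ℕ} (M : Matrix (Fin n) (Fin n) F) {i r s : Fin n}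
    (hr : i ≠ r) (hs : i ≠ s) (h : M i = M r + M s) : M.det = 0 := by
  rw [← Matrix.updateRow_eq_self M i, h, Matrix.det_updateRow_add,
    Matrix.det_zero_of_row_eq hr (by simp [hr.symm]),
    Matrix.det_zero_of_row_eq hs (by simp [hs.symm]), add_zero]

end JacobiTrudi

section Convolution

variable {F : Type*} [Field F]

/-- `g` is the sequence of coefficients of the inverse of the power series with coefficients
`c`. -/
structure IsConvInverse (g c : ℕ → F) : Prop where
  left_zero : g 0 = 1
  right_zero : c 0 = 1
  sum_eq_zero : ∀ n, 1 ≤ n → ∑ r ∈ Finset.range (n + 1), g r * c (n - r) = 0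

lemma exists_isConvInverse {c : ℕ → F} (h : c 0 = 1) : ∃ g, IsConvInverse g c := by
  have h0 : PowerSeries.constantCoeff (PowerSeries.mk c) ≠ 0 := by simp [h]
  refine ⟨fun n => PowerSeries.coeff n (PowerSeries.mk c)⁻¹, ?_, h, fun n hn => ?_⟩
  · simp [h]
  · have h1 := congrArg (PowerSeries.coeff n) (PowerSeries.inv_mul_cancel _ h0)
    rw [PowerSeries.coeff_mul, PowerSeries.coeff_one, if_neg (by omega),
      Finset.Nat.sum_antidiagonal_eq_sum_range_succ_mk] at h1
    simpa using h1

namespace IsConvInverse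

variable {g c g' c' : ℕ → F}

lemma eq_neg_sum (h : IsConvInverse g c) {n : ℕ} (hn : 1 ≤ n) :
    g n = -∑ r ∈ Finset.range n, g r * c (n - r) := by
  have h1 := h.sum_eq_zero n hn
  rw [Finset.sum_range_succ, Nat.sub_self, h.right_zero, mul_one] at h1
  exact eq_neg_of_add_eq_zero_right h1

lemma eq_of_forall_lt (h : IsConvInverse g c) (h' : IsConvInverse g' c') {τ : ℕ}
    (hc : ∀ n, n < τ → c' n = c n) : ∀ n, n < τ → g' n = g n := by
  intro n
  induction n using Nat.strong_induction_on with
  | _ n ih =>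
    intro hn
    rcases Nat.eq_zero_or_pos n with rfl | hpos
    · rw [h.left_zero, h'.left_zero]
    · rw [h.eq_neg_sum hpos, h'.eq_neg_sum hpos]
      refine congrArg _ (Finset.sum_congr rfl fun r hr => ?_)
      have := Finset.mem_range.1 hr
      rw [ih r this (by omega), hc _ (by omega)]

lemma ne_of_forall_lt (h : IsConvInverse g c) (h' : IsConvInverse g' c') {τ : ℕ} (hτ : 1 ≤ τ)
    (hc : ∀ n, n < τ → c' n = c n) (hne : c' τ ≠ c τ) : g' τ ≠ g τ := by
  obtain ⟨t, rfl⟩ := Nat.exists_eq_add_of_le' hτ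
  have hg := h.eq_of_forall_lt h' hc
  have hsum : ∑ r ∈ Finset.range t, g' (r + 1) * c' (t + 1 - (r + 1)) =
      ∑ r ∈ Finset.range t, g (r + 1) * c (t + 1 - (r + 1)) := by
    refine Finset.sum_congr rfl fun r hr => ?_
    have := Finset.mem_range.1 hr
    rw [hg _ (by omega), hc _ (by omega)]
  rw [h.eq_neg_sum hτ, h'.eq_neg_sum hτ, Finset.sum_range_succ', Finset.sum_range_succ',
    h.left_zero, h'.left_zero, hsum]
  simpa using hne

lemma eq_zero_of_lt (h : IsConvInverse g c) {s : ℕ} (hc : ∀ n, 1 ≤ n → n < s → c n = 0) {n : ℕ}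
    (hn : 1 ≤ n) (hns : n < s) : g n = 0 := by
  rw [h.eq_neg_sum hn, neg_eq_zero]
  have key : ∀ n, n < s → ∀ r ∈ Finset.range n, g r * c (n - r) = 0 := by
    intro n hn r hr
    have := Finset.mem_range.1 hr
    rw [hc _ (by omega) (by omega), mul_zero]
  exact Finset.sum_eq_zero (key n hns)

lemma eq_neg_of_forall_lt (h : IsConvInverse g c) {s : ℕ} (hs : 1 ≤ s)
    (hc : ∀ n, 1 ≤ n → n < s → c n = 0) : g s = -c s := by
  rw [h.eq_neg_sum hs, Finset.sum_eq_single 0]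
  · rw [h.left_zero, one_mul, Nat.sub_zero]
  · intro r hr h0
    have := Finset.mem_range.1 hr
    rw [hc _ (by omega) (by omega), mul_zero]
  · intro h0
    exact absurd (Finset.mem_range.2 hs) h0

lemma sum_hValue_mul (h : IsConvInverse g c) {x : ℕ → F} (l : ℤ) (n : ℕ)
    (hx : ∀ r : ℕ, 1 ≤ r → (r : ℤ) ≤ l + n → x r = g r) :
    ∑ j ∈ Finset.range (n + 1), hValue x (l + j) * c (n - j) =
      (if l + n = 0 then 1 else 0) -
        ∑ r ∈ Finset.range l.toNat, g r * c ((l + n).toNat - r) := by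
  have hval : ∀ j ∈ Finset.range (n + 1),
      hValue x (l + j) = if 0 ≤ l + j then g (l + j).toNat else 0 := by
    intro j hj
    have := Finset.mem_range.1 hj
    unfold hValue
    split_ifs with h1 h2 h3 h4
    · exact hx _ (by omega) (by omega)
    · omega
    · rw [h3, Int.toNat_zero, h.left_zero]
    · omega
    · omega
    · rfl
  have hfull : ∀ N : ℕ, ∑ r ∈ Finset.range (N + 1), g r * c (N - r) = if N = 0 then 1 else 0 := by
    intro N
    split_ifs with hN
    · simp [hN, h.left_zero, h.right_zero]
    · exact h.sum_eq_zero N (by omega)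
  rw [Finset.sum_congr rfl fun j hj => by rw [hval j hj]]
  rcases le_total 0 l with hl | hl
  · obtain ⟨L, rfl⟩ := Int.eq_ofNat_of_zero_le hl
    have h1 := hfull (L + n)
    rw [add_assoc, Finset.sum_range_add] at h1
    have h2 : ((L : ℤ) + n = 0) = (L + n = 0) := by
      rw [eq_iff_iff]
      omega
    have h3 : ((L : ℤ) + n).toNat = L + n := by omega
    simp only [Int.toNat_natCast, h2, h3]
    rw [← h1, add_sub_cancel_left]
    refine Finset.sum_congr rfl fun j _ => ?_
    have h4 : ((L : ℤ) + j).toNat = L + j := by omega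
    rw [if_pos (by omega), Nat.add_sub_add_left, h4]
  · obtain ⟨M, hM⟩ := Int.eq_ofNat_of_zero_le (neg_nonneg.2 hl)
    obtain rfl : l = -M := by omega
    have h2 : (-(M : ℤ)).toNat = 0 := by omega
    rw [h2, Finset.range_zero, Finset.sum_empty, sub_zero]
    rcases lt_or_ge n M with hn | hn
    · rw [if_neg (by omega)]
      refine Finset.sum_eq_zero fun j hj => ?_
      have := Finset.mem_range.1 hj
      rw [if_neg (by omega), zero_mul]
    · obtain ⟨d, rfl⟩ := Nat.exists_eq_add_of_le hn
      have h3 : (-(M : ℤ) + ((M + d : ℕ) : ℤ) = 0) = (d = 0) := by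
        rw [eq_iff_iff]
        omega
      simp only [h3]
      rw [add_assoc, Finset.sum_range_add, Finset.sum_eq_zero, zero_add, ← hfull d]
      · refine Finset.sum_congr rfl fun j _ => ?_
        have h4 : (-(M : ℤ) + ((M + j : ℕ) : ℤ)).toNat = j := by omega
        rw [if_pos (by omega), h4, Nat.add_sub_add_left]
      · intro j hj
        have := Finset.mem_range.1 hj
        rw [if_neg (by omega), zero_mul]

end IsConvInverse

/-- The upper triangular Toeplitz matrix with symbol `c`. -/
def upperToeplitz (k : ℕ) (c : ℕ → F) : Matrix (Fin k) (Fin k) F :=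
  Matrix.of fun j n => if j ≤ n then c (n - j) else 0

lemma det_upperToeplitz_ne_zero (k : ℕ) {c : ℕ → F} (h : c 0 = 1) :
    (upperToeplitz k c).det ≠ 0 := by
  refine det_ne_zero_of_pivots _ id (fun j => k - j) (fun j => ?_) (fun j j' hne hA => ?_)
  · simp [upperToeplitz, h]
  · have hle : j ≤ j' := by
      by_contra hlt
      exact hA (if_neg hlt)
    have := lt_of_le_of_ne hle hne.symm
    rw [Fin.lt_def] at this
    have := j'.2
    omega

lemma IsConvInverse.JTmat_mul_upperToeplitz {g c : ℕ → F} (h : IsConvInverse g c) {k : ℕ}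
    {lam : ℕ → ℕ} {x : ℕ → F} {i n : Fin k}
    (hx : ∀ r : ℕ, 1 ≤ r → (r : ℤ) ≤ (lam i : ℤ) - i + n → x r = g r) :
    (JTmat F k lam x * upperToeplitz k c) i n =
      (if (lam i : ℤ) - i + n = 0 then 1 else 0) -
        ∑ r ∈ Finset.range ((lam i : ℤ) - i).toNat, g r * c (((lam i : ℤ) - i + n).toNat - r) := by
  rw [← h.sum_hValue_mul _ _ hx, Matrix.mul_apply]
  simp only [JTmat_apply, upperToeplitz, Matrix.of_apply, Fin.le_def, mul_ite, mul_zero]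
  rw [Fin.sum_univ_eq_sum_range (fun j => if j ≤ (n : ℕ) then
    hValue x ((lam i : ℤ) - i + j) * c (n - j) else 0) k, ← Finset.sum_filter]
  refine Finset.sum_congr ?_ fun _ _ => rfl
  ext j
  have := n.2
  simp only [Finset.mem_filter, Finset.mem_range]
  omega

end Convolution

section FattenedHook

variable (F : Type*) [Field F] [Fintype F] {a b p m : ℕ}

lemma isPartition_hook (hb : 1 ≤ b) (hab : b < a) :
    IsPartition (p + m) (fun i => if i < p then a else b) := by
  refine ⟨fun i _ => ?_, fun i _ => ?_⟩ <;> simp only <;> split_ifs <;> omega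

theorem hook_of_lt (hm : 1 ≤ m) (hp : 1 ≤ p) (hpb : p < b) (hab : b < a) :
    1 / (Fintype.card F : ℚ) <
      probEq F (p + m) (fun i => if i < p then a else b) (a + (p + m - 1)) 0 := by
  obtain ⟨r, hr⟩ : ∃ r, r = min b (p + m) := ⟨_, rfl⟩
  obtain ⟨τ, hτ⟩ : ∃ τ, τ = max b (p + m) := ⟨_, rfl⟩
  refine one_div_card_lt_probEq (isPartition_hook (by omega) hab) (by omega)
    (by split_ifs <;> omega) (fun _ => 0) (fun n => if (n : ℤ) = τ then 1 else 0) τ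
    (by omega) (by omega) (fun n _ hn => if_neg (by omega)) (by simp)
    (Matrix.of fun i j : Fin (p + m) =>
      if (((if (i : ℕ) < p then a else b : ℕ) : ℤ) - (i : ℤ) + (j : ℤ)) < τ then
        JTmat F (p + m) (fun i => if i < p then a else b) (fun _ => 0) i j
      else if (i : ℕ) = (if (j : ℕ) + r < p + m then (j : ℕ) + r else j + r - (p + m)) then 1
      else 0)
    (det_ne_zero_of_pivots _
      (fun j => ⟨if (j : ℕ) + r < p + m then (j : ℕ) + r else j + r - (p + m),
        by split_ifs <;> omega⟩) (fun _ => 0) (fun j => ?_) (fun j j' hne hA => ?_))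
    (fun i j hl => if_pos hl) (fun x hx => ?_) ?_
  · have hj := j.2
    simp only [Matrix.of_apply, JTmat_apply, hValue_zero]
    split_ifs <;> first | omega | exact one_ne_zero
  · exfalso
    apply hA
    have hj := j.2
    have hj' := j'.2
    have hne' : (j' : ℕ) ≠ j := fun h => hne (Fin.ext h)
    simp only [Matrix.of_apply, JTmat_apply, hValue_zero]
    split_ifs <;> first | omega | rfl
  · refine Matrix.det_eq_zero_of_row_eq_zero ⟨r - 1, by omega⟩ fun j => ?_
    have hj := j.2
    rw [JTmat_apply, hValue_congr (y := fun _ => 0), hValue_zero, if_neg]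
    · simp only
      split_ifs <;> omega
    · intro n h1 h2
      refine hx n h1 ?_
      simp only at h2
      split_ifs at h2 <;> omega
  · by_cases haτ : τ < a
    · refine Matrix.det_eq_zero_of_row_eq_zero ⟨0, by omega⟩ fun j => ?_
      rw [JTmat_apply, hValue_indicator fun l => l = (τ : ℤ), if_neg]
      simp only
      split_ifs <;> omega
    · refine Matrix.det_zero_of_row_eq (i := ⟨0, by omega⟩) (j := ⟨p + m - a + b, by omega⟩)
        (fun h => ?_) (funext fun j => ?_)
      · rw [Fin.ext_iff] at h
        simp only at h
        omega
      · have hj := j.2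
        rw [JTmat_apply, JTmat_apply, hValue_indicator fun l => l = (τ : ℤ),
          hValue_indicator fun l => l = (τ : ℤ)]
        congr 1
        simp only [eq_iff_iff]
        split_ifs <;> omega

theorem hook_of_gt (hm : 1 ≤ m) (hb : 1 ≤ b) (hpb : b < p) (hab : b < a) :
    1 / (Fintype.card F : ℚ) <
      probEq F (p + m) (fun i => if i < p then a else b) (a + (p + m - 1)) 0 := by
  obtain ⟨r, hr⟩ : ∃ r, r = min a p := ⟨_, rfl⟩
  obtain ⟨τ, hτ⟩ : ∃ τ, τ = max a p := ⟨_, rfl⟩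
  refine one_div_card_lt_probEq (isPartition_hook hb hab) (by omega)
    (by split_ifs <;> omega) (fun _ => 0)
    (fun n => if (τ : ℤ) ∣ (n : ℤ) then 1 else 0) τ
    (by omega) (by omega) (fun n hn hn' => if_neg fun h => ?_) (by simp)
    (Matrix.of fun i j : Fin (p + m) =>
      if (((if (i : ℕ) < p then a else b : ℕ) : ℤ) - (i : ℤ) + (j : ℤ)) < τ then
        JTmat F (p + m) (fun i => if i < p then a else b) (fun _ => 0) i j
      else if (i : ℕ) = (if (j : ℕ) < p - r then (j : ℕ) + r
        else if (j : ℕ) < p - b then j - (p - r)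
        else if (j : ℕ) < p - b + m then j + b else j - m - (p - r)) then 1
      else 0)
    (det_ne_zero_of_pivots _
      (fun j => ⟨if (j : ℕ) < p - r then (j : ℕ) + r else if (j : ℕ) < p - b then j - (p - r)
        else if (j : ℕ) < p - b + m then j + b else j - m - (p - r),
        by split_ifs <;> omega⟩) (fun _ => 0) (fun j => ?_) (fun j j' hne hA => ?_))
    (fun i j hl => if_pos hl) (fun x hx => ?_) ?_
  · have := Int.le_of_dvd (by omega) h
    omega
  · have hj := j.2
    simp only [Matrix.of_apply, JTmat_apply, hValue_zero]
    split_ifs <;> first | omega | exact one_ne_zero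
  · exfalso
    apply hA
    have hj := j.2
    have hj' := j'.2
    have hne' : (j' : ℕ) ≠ j := fun h => hne (Fin.ext h)
    simp only [Matrix.of_apply, JTmat_apply, hValue_zero]
    split_ifs <;> first | omega | rfl
  · refine det_eq_zero_of_zero_block_s13 _
      (Finset.Ico ⟨r - b - 1, by omega⟩ ⟨r, by omega⟩ ∪ Finset.Ici ⟨p, by omega⟩)
      (Finset.Iio ⟨p - b, by omega⟩) (fun i hi j hj => ?_) ?_
    · simp only [Finset.mem_union, Finset.mem_Ico, Finset.mem_Ici, Finset.mem_Iio, Fin.le_def,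
        Fin.lt_def] at hi hj
      rw [JTmat_apply, hValue_congr (y := fun _ => 0), hValue_zero, if_neg]
      · split_ifs <;> omega
      · intro n h1 h2
        refine hx n h1 ?_
        split_ifs at h2 <;> omega
    · rw [Finset.card_union_of_disjoint, Fin.card_Ico, Fin.card_Ici, Fin.card_Iio]
      · simp only
        omega
      · rw [Finset.disjoint_left]
        intro i hi hi'
        simp only [Finset.mem_Ico, Finset.mem_Ici, Fin.le_def, Fin.lt_def] at hi hi'
        omega
  · refine Matrix.det_zero_of_row_eq (i := ⟨p, by omega⟩) (j := ⟨r - b, by omega⟩)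
      (fun h => ?_) (funext fun j => ?_)
    · rw [Fin.ext_iff] at h
      simp only at h
      omega
    · have hj := j.2
      have h1 : ((if p < p then a else b : ℕ) : ℤ) - (p : ℤ) + (j : ℤ) = b - p + j := by simp
      have h2 : ((if r - b < p then a else b : ℕ) : ℤ) - ((r - b : ℕ) : ℤ) + (j : ℤ) =
          b - p + j + τ := by
        rw [if_pos (by omega)]
        omega
      rw [JTmat_apply, JTmat_apply, hValue_indicator fun l => (τ : ℤ) ∣ l,
        hValue_indicator fun l => (τ : ℤ) ∣ l, h1, h2]
      congr 1
      rw [eq_iff_iff, dvd_add_self_right]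
      constructor
      · rintro (h | h)
        · exact Or.inr ⟨by omega, h ▸ dvd_zero _⟩
        · exact Or.inr ⟨by omega, h.2⟩
      · rintro (h | h)
        · omega
        · by_cases h0 : (b : ℤ) - p + j = 0
          · exact Or.inl h0
          · refine Or.inr ⟨?_, h.2⟩
            by_contra hneg
            have := Int.le_of_dvd (by omega) ((dvd_neg).2 h.2)
            omega

end FattenedHook

section FattenedHook

variable {F : Type*} [Field F] {a b m : ℕ}

lemma hook_completion_det_ne_zero (hm : 1 ≤ m) (hb : 2 ≤ b) (ha : b + m ≤ a)
    (A : Matrix (Fin (b + m)) (Fin (b + m)) F)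
    (hA : ∀ i j : Fin (b + m), A i j ≠ 0 ↔
      ((i : ℕ) < b ∧ ((a : ℤ) - i + j = b + m - 1 ∨ (j : ℤ) + 1 = i ∨ (j : ℤ) + 2 = m + i)) ∨
      (b ≤ (i : ℕ) ∧ (b + j = (i : ℕ) ∨ (j : ℤ) + 1 = i + m ∨ (b : ℤ) - i + j = a - 1)) ∨
      ((i : ℕ) = 0 ∧ (j : ℕ) = b + m - 2)) : A.det ≠ 0 := by
  refine det_ne_zero_of_pivots _
    (fun j => ⟨if (j : ℕ) = 0 then 1 else if (j : ℕ) < m then b + j else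
      if (j : ℕ) < b + m - 2 then j - m + 2 else if (j : ℕ) = b + m - 2 then 0 else b,
      by have := j.2; split_ifs <;> omega⟩)
    (fun j => if (j : ℕ) = 0 then 1 else if (j : ℕ) < m then 0 else
      if (j : ℕ) < b + m - 2 then 3 + j else if (j : ℕ) = b + m - 2 then 2 * (b + m) + 5 else 2)
    (fun j => ?_) (fun j j' hne h => ?_)
  · have hj := j.2
    rw [hA]
    simp only
    split_ifs <;> omega
  · have hj := j.2
    have hj' := j'.2
    have hne' : (j' : ℕ) ≠ j := fun h => hne (Fin.ext h)
    rw [hA] at h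
    simp only at h ⊢
    split_ifs at h ⊢ <;> (try simp only [false_and, or_false] at h) <;> omega

variable (F) in
theorem hook_of_eq_of_le [Fintype F] (hm : 1 ≤ m) (hb : 2 ≤ b) (ha : b + m ≤ a) :
    1 / (Fintype.card F : ℚ) <
      probEq F (b + m) (fun i => if i < b then a else b) (a + (b + m - 1)) 0 := by
  obtain ⟨τ, hτ⟩ : ∃ τ, τ = a + m + b - 2 := ⟨_, rfl⟩
  let P : ℤ → Prop := fun l => l = b + m - 1 ∨ l = a - 1 ∨ l = a + m - 2
  let Q : ℤ → Prop := fun l => P l ∨ l = τ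
  have hP : ∀ l, hValue (fun n : ℕ => if P n then (1 : F) else 0) l =
      if l = 0 ∨ (l = b + m - 1 ∨ l = a - 1 ∨ l = a + m - 2) then 1 else 0 := by
    intro l
    rw [hValue_indicator]
    congr 1
    simp only [P, eq_iff_iff]
    omega
  have hQ : ∀ l, hValue (fun n : ℕ => if Q n then (1 : F) else 0) l =
      if l = 0 ∨ ((l = b + m - 1 ∨ l = a - 1 ∨ l = a + m - 2) ∨ l = τ) then 1 else 0 := by
    intro l
    rw [hValue_indicator]
    congr 1
    simp only [P, Q, eq_iff_iff]
    omega
  refine one_div_card_lt_probEq (isPartition_hook (by omega) (by omega)) (by omega)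
    (by split_ifs <;> omega) (fun n : ℕ => if P n then (1 : F) else 0)
    (fun n : ℕ => if Q n then (1 : F) else 0) τ
    (by omega) (by omega) (fun n _ hn => ?_) ?_
    (Matrix.of fun i j : Fin (b + m) =>
      if (((if (i : ℕ) < b then a else b : ℕ) : ℤ) - (i : ℤ) + (j : ℤ)) < τ then
        JTmat F (b + m) (fun i => if i < b then a else b)
          (fun n : ℕ => if P n then (1 : F) else 0) i j
      else if (i : ℕ) = 0 ∧ (j : ℕ) = b + m - 2 then 1 else 0)
    (hook_completion_det_ne_zero hm hb ha _ fun i j => ?_)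
    (fun i j hl => if_pos hl) (fun x hx => ?_) ?_
  · refine if_congr ?_ rfl rfl
    simp only [P, Q]
    omega
  · rw [if_pos, if_neg]
    · exact one_ne_zero
    · simp only [P]
      omega
    · simp only [Q, or_true]
  · have hi := i.2
    have hj := j.2
    rw [Matrix.of_apply, JTmat_apply, hP]
    split_ifs <;> first
      | (simp only [ne_eq, one_ne_zero, not_false_eq_true, true_iff]; omega)
      | (simp only [ne_eq, not_true_eq_false, false_iff]; omega)
  · refine Matrix.det_eq_zero_of_column_eq_zero ⟨b + m - 2, by omega⟩ fun i => ?_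
    have hi := i.2
    rw [JTmat_apply, hValue_congr (y := fun n : ℕ => if P n then (1 : F) else 0), hP, if_neg]
    · simp only
      split_ifs <;> omega
    · intro n h1 h2
      refine hx n h1 ?_
      simp only at h2
      split_ifs at h2 <;> omega
  · by_cases hm1 : m = 1
    · refine Matrix.det_zero_of_row_eq (i := ⟨1, by omega⟩) (j := ⟨b, by omega⟩)
        (fun h => ?_) (funext fun j => ?_)
      · rw [Fin.ext_iff] at h
        simp only at h
        omega
      · have hj := j.2
        rw [JTmat_apply, JTmat_apply, hQ, hQ]
        congr 1
        simp only [eq_iff_iff]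
        split_ifs <;> omega
    · refine det_eq_zero_of_row_eq_add _ (i := ⟨1, by omega⟩) (r := ⟨b, by omega⟩)
        (s := ⟨b + m - 1, by omega⟩) (fun h => ?_) (fun h => ?_) (funext fun j => ?_)
      · rw [Fin.ext_iff] at h
        simp only at h
        omega
      · rw [Fin.ext_iff] at h
        simp only at h
        omega
      · have hj := j.2
        rw [Pi.add_apply, JTmat_apply, JTmat_apply, JTmat_apply, hQ, hQ, hQ]
        simp only
        split_ifs <;> first | omega | simp

lemma IsConvInverse.hook_mul_upperToeplitz {g c : ℕ → F} (h : IsConvInverse g c) (hb : 1 ≤ b)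
    (hab : b < a) (hc : ∀ n, 1 ≤ n → n < a - 1 → c n = 0) (hc1 : c (a - 1) = 1) {x : ℕ → F}
    {i n : Fin (b + m)}
    (hx : ∀ r : ℕ, 1 ≤ r →
      (r : ℤ) ≤ ((if (i : ℕ) < b then a else b : ℕ) : ℤ) - i + n → x r = g r) :
    (JTmat F (b + m) (fun i => if i < b then a else b) x * upperToeplitz (b + m) c) i n =
      if (i : ℕ) < b then -c (n + a - i) + (if (i : ℕ) = 0 then c (n + 1) else 0)
      else if n + b = (i : ℕ) then 1 else 0 := by
  rw [h.JTmat_mul_upperToeplitz hx]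
  by_cases hi : (i : ℕ) < b
  · have h1 : ((a : ℤ) - i).toNat = a - i := by omega
    have h2 : ((a : ℤ) - i + n).toNat = n + a - i := by omega
    obtain ⟨l, hl⟩ : ∃ l, a - i = l + 1 := ⟨a - i - 1, by omega⟩
    simp only [if_pos hi, h1, h2]
    rw [if_neg (by omega), hl, Finset.sum_range_succ', h.left_zero]
    by_cases h0 : (i : ℕ) = 0
    · obtain ⟨s, rfl⟩ : ∃ s, l = s + 1 := ⟨l - 1, by omega⟩
      have h3 : s + 1 = a - 1 := by omega
      have h4 : (n : ℕ) + a - i - (a - 1) = n + 1 := by omega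
      rw [if_pos h0, Finset.sum_range_succ, Finset.sum_eq_zero, h3,
        h.eq_neg_of_forall_lt (by omega) hc, hc1, h4]
      · simp
      · intro r hr
        have := Finset.mem_range.1 hr
        rw [h.eq_zero_of_lt hc (by omega) (by omega), zero_mul]
    · rw [if_neg h0, Finset.sum_eq_zero]
      · simp
      · intro r hr
        have := Finset.mem_range.1 hr
        rw [h.eq_zero_of_lt hc (by omega) (by omega), zero_mul]
  · have h1 : ((b : ℤ) - i).toNat = 0 := by omega
    have h2 : ((b : ℤ) - i + n = 0) = (n + b = (i : ℕ)) := by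
      rw [eq_iff_iff]
      omega
    simp only [if_neg hi, h1, h2, Finset.range_zero, Finset.sum_empty, sub_zero]

lemma hook_product_det_ne_zero (hm : 1 ≤ m) (hb : 2 ≤ b) (hab : b < a) (ha : a < b + m)
    (B : Matrix (Fin (b + m)) (Fin (b + m)) F)
    (hB0 : ∀ i j : Fin (b + m), (i : ℕ) = 0 → (j : ℕ) = b + m - 2 → B i j ≠ 0)
    (hB1 : ∀ i j : Fin (b + m), 1 ≤ (i : ℕ) → (i : ℕ) < b → (B i j ≠ 0 ↔
      (j : ℕ) + 1 = i ∨ (j : ℕ) + a + 1 = b + m + i ∨ (j : ℕ) + 2 = i + m ∨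
        (j : ℕ) + 2 = b + m + i))
    (hB2 : ∀ i j : Fin (b + m), b ≤ (i : ℕ) → (B i j ≠ 0 ↔ (j : ℕ) + b = i)) :
    B.det ≠ 0 := by
  refine det_ne_zero_of_pivots _
    (fun j => ⟨if (j : ℕ) < m then b + j else if (j : ℕ) < b + m - 2 then j - m + 2 else
      if (j : ℕ) = b + m - 2 then 0 else 1, by have := j.2; split_ifs <;> omega⟩)
    (fun j => if (j : ℕ) < m then 0 else if (j : ℕ) < b + m - 2 then 3 + j else
      if (j : ℕ) = b + m - 2 then 2 * (b + m) + 5 else 1)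
    (fun j => ?_) (fun j j' hne h => ?_)
  · have hj := j.2
    by_cases h1 : (j : ℕ) < m
    · refine (hB2 _ _ ?_).2 ?_ <;> simp only [if_pos h1] <;> omega
    · by_cases h2 : (j : ℕ) = b + m - 2
      · exact hB0 _ _ (by simp only; split_ifs <;> omega) h2
      · refine (hB1 _ _ ?_ ?_).2 ?_ <;> simp only [if_neg h1, if_neg h2] <;> split_ifs <;> omega
  · have hj := j.2
    have hj' := j'.2
    have hne' : (j' : ℕ) ≠ j := fun h => hne (Fin.ext h)
    by_cases h1 : (j : ℕ) < m
    · rw [hB2 _ _ (by simp only; split_ifs; omega)] at h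
      simp only [if_pos h1] at h
      omega
    · by_cases h2 : (j : ℕ) = b + m - 2
      · split_ifs <;> omega
      · rw [hB1 _ _ (by simp only; split_ifs <;> omega) (by simp only; split_ifs <;> omega)] at h
        simp only [if_neg h1, if_neg h2] at h ⊢
        split_ifs at h ⊢ <;> omega

variable (F) in
theorem hook_of_eq_of_lt [Fintype F] (hm : 1 ≤ m) (hb : 2 ≤ b) (hab : b < a) (ha : a < b + m) :
    1 / (Fintype.card F : ℚ) <
      probEq F (b + m) (fun i => if i < b then a else b) (a + (b + m - 1)) 0 := by
  obtain ⟨τ, hτ⟩ : ∃ τ, τ = a + m + b - 2 := ⟨_, rfl⟩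
  obtain ⟨c', hc'⟩ : ∃ c' : ℕ → F, ∀ n, c' n =
      if n = 0 ∨ n + 1 = a ∨ n + 1 = b + m ∨ n + 2 = a + m then 1 else 0 := ⟨_, fun _ => rfl⟩
  obtain ⟨c, hc⟩ : ∃ c : ℕ → F, ∀ n, c n =
      if n = 0 ∨ n + 1 = a ∨ n + 1 = b + m ∨ n + 2 = a + m ∨ n = τ then 1 else 0 :=
    ⟨_, fun _ => rfl⟩
  obtain ⟨g, hg⟩ := exists_isConvInverse (c := c) (by simp [hc])
  obtain ⟨g', hg'⟩ := exists_isConvInverse (c := c') (by simp [hc'])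
  have hcc' : ∀ n, n < τ → c' n = c n := by
    intro n hn
    rw [hc, hc']
    refine if_congr ?_ rfl rfl
    omega
  have hne : c' τ ≠ c τ := by
    rw [hc, hc', if_neg (by omega), if_pos (by omega)]
    exact zero_ne_one
  have hsmall : ∀ n, 1 ≤ n → n < a - 1 → c n = 0 := fun n _ _ => by rw [hc, if_neg (by omega)]
  have hsmall' : ∀ n, 1 ≤ n → n < a - 1 → c' n = 0 := fun n _ _ => by rw [hc', if_neg (by omega)]
  have hone : c (a - 1) = 1 := by rw [hc, if_pos (by omega)]
  have hone' : c' (a - 1) = 1 := by rw [hc', if_pos (by omega)]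
  have hT : (upperToeplitz (b + m) c).det ≠ 0 := det_upperToeplitz_ne_zero _ hg.right_zero
  have hT' : (upperToeplitz (b + m) c').det ≠ 0 := det_upperToeplitz_ne_zero _ hg'.right_zero
  refine one_div_card_lt_probEq (isPartition_hook (by omega) hab) (by omega)
    (by split_ifs <;> omega) g g' τ (by omega) (by omega)
    (fun n _ hn => hg.eq_of_forall_lt hg' hcc' n hn)
    (hg.ne_of_forall_lt hg' (by omega) hcc' hne)
    (JTmat F (b + m) (fun i => if i < b then a else b) g +
      Matrix.of fun i j : Fin (b + m) => if (i : ℕ) = 0 ∧ (j : ℕ) = b + m - 2 then 1 else 0)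
    (fun h0 => ?_) (fun i j hl => ?_) (fun x hx => ?_) ?_
  · have hE : ∀ i n : Fin (b + m),
        ((Matrix.of fun i j : Fin (b + m) => if (i : ℕ) = 0 ∧ (j : ℕ) = b + m - 2 then (1 : F)
          else 0) * upperToeplitz (b + m) c) i n =
        if (i : ℕ) = 0 then upperToeplitz (b + m) c ⟨b + m - 2, by omega⟩ n else 0 := by
      intro i n
      rw [Matrix.mul_apply, Finset.sum_eq_single ⟨b + m - 2, by omega⟩]
      · simp
      · intro j _ hj
        rw [Matrix.of_apply, if_neg, zero_mul]
        exact fun h => hj (Fin.ext h.2)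
      · simp
    refine hook_product_det_ne_zero hm hb hab ha
      ((JTmat F (b + m) (fun i => if i < b then a else b) g +
        Matrix.of fun i j : Fin (b + m) => if (i : ℕ) = 0 ∧ (j : ℕ) = b + m - 2 then 1 else 0) *
          upperToeplitz (b + m) c) (fun i n hi hn => ?_) (fun i n hi hib => ?_)
      (fun i n hi => ?_) (by rw [Matrix.det_mul, h0, zero_mul])
    · have h1 : (n : ℕ) + a - i = τ := by omega
      have h2 : c 0 = 1 := hg.right_zero
      rw [add_mul, Matrix.add_apply, hE,
        hg.hook_mul_upperToeplitz (by omega) hab hsmall hone fun _ _ _ => rfl, h1]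
      simp only [upperToeplitz, Matrix.of_apply, Fin.le_def, hi, hn, le_refl, Nat.sub_self, if_true,
        h2]
      rw [if_pos (by omega), hc τ, if_pos (by omega), hc, if_pos (by omega)]
      simp
    · rw [add_mul, Matrix.add_apply, hE,
        hg.hook_mul_upperToeplitz (by omega) hab hsmall hone fun _ _ _ => rfl, if_pos hib,
        if_neg (by omega), if_neg (by omega), add_zero, add_zero, neg_ne_zero, hc]
      rw [ne_eq, ite_eq_right_iff, Classical.not_imp]
      simp only [one_ne_zero, not_false_eq_true, and_true]
      omega
    · rw [add_mul, Matrix.add_apply, hE,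
        hg.hook_mul_upperToeplitz (by omega) hab hsmall hone fun _ _ _ => rfl,
        if_neg (by omega), if_neg (by omega : ¬((i : ℕ) = 0)), add_zero]
      simp
  · rw [Matrix.add_apply, Matrix.of_apply, if_neg, add_zero]
    rintro ⟨h1, h2⟩
    split_ifs at hl <;> omega
  · have h0 : (JTmat F (b + m) (fun i => if i < b then a else b) x *
        upperToeplitz (b + m) c).det = 0 := by
      refine Matrix.det_eq_zero_of_column_eq_zero ⟨b + m - 2, by omega⟩ fun i => ?_
      have hi := i.2
      rw [hg.hook_mul_upperToeplitz (by omega) hab hsmall hone fun r h1 h2 => hx r h1 ?_]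
      · simp only [hc]
        split_ifs <;> first | omega | simp
      · simp only at h2
        split_ifs at h2 <;> omega
    rw [Matrix.det_mul] at h0
    exact (mul_eq_zero.1 h0).resolve_right hT
  · have h0 : (JTmat F (b + m) (fun i => if i < b then a else b) g' *
        upperToeplitz (b + m) c').det = 0 := by
      refine det_eq_zero_of_zero_block_s13 _ (insert ⟨1, by omega⟩ (Finset.Ici ⟨b, by omega⟩))
        (Finset.Ici ⟨m, by omega⟩) (fun i hi n hn => ?_) ?_
      · have hi' := i.2
        have hn' := n.2
        rw [Finset.mem_insert, Finset.mem_Ici, Fin.ext_iff, Fin.le_def] at hi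
        rw [Finset.mem_Ici, Fin.le_def] at hn
        simp only at hi hn
        rw [hg'.hook_mul_upperToeplitz (by omega) hab hsmall' hone' fun _ _ _ => rfl]
        simp only [hc']
        split_ifs <;> first | omega | simp
      · rw [Finset.card_insert_of_notMem, Fin.card_Ici, Fin.card_Ici]
        · simp only
          omega
        · rw [Finset.mem_Ici, Fin.le_def]
          simp only
          omega
    rw [Matrix.det_mul] at h0
    exact (mul_eq_zero.1 h0).resolve_right hT'

end FattenedHook

/-- For a fattened hook `λ = (a^p, b^m)` with `a > b ≥ 2`, `P(s_λ ↦ 0) > 1/q`. -/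
theorem prob_fattened_hook_gt (F : Type*) [Field F] [Fintype F]
    (a b p m : ℕ) (hp : 1 ≤ p) (hm : 1 ≤ m) (hb : 2 ≤ b) (hab : b < a) :
    1 / (Fintype.card F : ℚ) <
      probEq F (p + m) (fun i => if i < p then a else b) (a + (p + m - 1)) 0 := by
  rcases lt_trichotomy p b with h | rfl | h
  · exact hook_of_lt F hm hp h hab
  · rcases le_or_gt (p + m) a with ha | ha
    · exact hook_of_eq_of_le F hm hb ha
    · exact hook_of_eq_of_lt F hm hb hab ha
  · exact hook_of_gt F hm (by omega) h hab
end

section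
/- Fix an integer c and consider the family of rectangular shapes {(k^ℓ) : k − ℓ = c, k ≥ 1, ℓ ≥ 1}. The vanishing events {s_{(k^ℓ)} ↦ 0} for this family are set-wise independent: for any finite collection of distinct rectangles λ⁽¹⁾,…,λ⁽ʳ⁾ from this family, P(s_{λ⁽¹⁾} ↦ 0, …, s_{λ⁽ʳ⁾} ↦ 0) = 1/q^r = ∏_{i=1}^r P(s_{λ⁽ⁱ⁾} ↦ 0). -/
open Finset Classical

/-- The joint probability that the Jacobi–Trudi determinants of the partitions
`lams i` (with `ks i` parts) all vanish, with `h_1, …, h_N` chosen uniformly at random. -/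
noncomputable def probJoint (F : Type*) [Field F] [Fintype F]
    {r : ℕ} (ks : Fin r → ℕ) (lams : Fin r → ℕ → ℕ) (N : ℕ) : ℚ :=
  ((Finset.univ.filter fun b : Fin N → F =>
      ∀ i : Fin r, (JTmat F (ks i) (lams i) (extFin b)).det = 0).card : ℚ) /
    (Fintype.card F : ℚ) ^ N

/-- A tuple of length `M` as a function on `ℤ`, supported on `{0, …, M - 1}`. -/
def tupleExt {F : Type*} [Zero F] {M : ℕ} (b : Fin M → F) (n : ℤ) : F :=
  if h : 0 ≤ n ∧ n < M then b ⟨n.toNat, by omega⟩ else 0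

/-- The `l × l` Toeplitz matrix with `(i, j)` entry `a (k - i + j)`. -/
def toeplitz {F : Type*} (a : ℤ → F) (k : ℤ) (l : ℕ) : Matrix (Fin l) (Fin l) F :=
  Matrix.of fun i j => a (k - i + j)

/-- The coefficients of a power series as a function on `ℤ`. -/
noncomputable def coeffExt {F : Type*} [Field F] (f : PowerSeries F) (n : ℤ) : F :=
  if 0 ≤ n then PowerSeries.coeff n.toNat f else 0

theorem toeplitz_congr {F : Type*} {a a' : ℤ → F} {k k' : ℤ} {l : ℕ}
    (h : ∀ d : ℤ, -l < d → d < l → a (k + d) = a' (k' + d)) :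
    toeplitz a k l = toeplitz a' k' l := by
  ext i j
  have := h (j - i) (by omega) (by omega)
  simpa only [toeplitz, Matrix.of_apply, sub_add_eq_add_sub, add_sub_assoc] using this

theorem card_subtype_fin_succ {F : Type*} [Fintype F] {M : ℕ} (P : (Fin (M + 1) → F) → Prop) :
    Nat.card {b // P b} = ∑ u : F, Nat.card {b : Fin M → F // P (Fin.cons u b)} := by
  rw [← Nat.card_sigma]
  refine Nat.card_congr (Equiv.trans ?_
    (Equiv.subtypeProdEquivSigmaSubtype fun (u : F) (b : Fin M → F) => P (Fin.cons u b)))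
  exact ((Fin.consEquiv fun _ : Fin (M + 1) => F).subtypeEquiv fun _ => Iff.rfl).symm

section

variable {F : Type*} [Field F]

theorem tupleExt_cons_zero {M : ℕ} (u : F) (b : Fin M → F) :
    tupleExt (Fin.cons u b : Fin (M + 1) → F) 0 = u := by
  unfold tupleExt
  rw [dif_pos (by omega)]
  rfl

theorem tupleExt_cons_of_ne_zero {M : ℕ} (u : F) (b : Fin M → F) {n : ℤ} (hn : n ≠ 0) :
    tupleExt (Fin.cons u b : Fin (M + 1) → F) n = tupleExt b (n - 1) := by
  unfold tupleExt
  by_cases h : 0 ≤ n - 1 ∧ n - 1 < M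
  · rw [dif_pos (by omega), dif_pos h]
    have : (⟨n.toNat, by omega⟩ : Fin (M + 1)) = Fin.succ ⟨(n - 1).toNat, by omega⟩ := by
      ext
      simp only [Fin.val_succ]
      omega
    rw [this, Fin.cons_succ]
  · rw [dif_neg (by omega), dif_neg h]

theorem tupleExt_of_neg {M : ℕ} (b : Fin M → F) {n : ℤ} (hn : n < 0) : tupleExt b n = 0 := by
  unfold tupleExt
  rw [dif_neg (by omega)]

theorem tupleExt_natCast {M : ℕ} (b : Fin M → F) (i : Fin M) : tupleExt b (i : ℤ) = b i := by
  unfold tupleExt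
  rw [dif_pos (by omega)]
  rfl

theorem coeff_mul_eq_sum_coeffExt (f V : PowerSeries F) {l : ℕ}
    (hV : ∀ n, l ≤ n → PowerSeries.coeff n V = 0) (n : ℕ) :
    PowerSeries.coeff n (f * V) =
      ∑ i : Fin l, PowerSeries.coeff (i : ℕ) V * coeffExt f ((n : ℤ) - i) := by
  rw [mul_comm, PowerSeries.coeff_mul,
    Finset.Nat.sum_antidiagonal_eq_sum_range_succ
      (fun i j => PowerSeries.coeff i V * PowerSeries.coeff j f),
    Fin.sum_univ_eq_sum_range (fun i => PowerSeries.coeff i V * coeffExt f ((n : ℤ) - i))]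
  have h₁ : ∑ i ∈ Finset.range n.succ, PowerSeries.coeff i V * PowerSeries.coeff (n - i) f =
      ∑ i ∈ Finset.range n.succ, PowerSeries.coeff i V * coeffExt f ((n : ℤ) - i) := by
    refine Finset.sum_congr rfl fun i hi => ?_
    rw [Finset.mem_range] at hi
    unfold coeffExt
    rw [if_pos (by omega), show ((n : ℤ) - i).toNat = n - i by omega]
  rw [h₁]
  have h₂ := Finset.sum_subset (s₁ := Finset.range n.succ) (s₂ := Finset.range (l + n.succ))
    (f := fun i : ℕ => PowerSeries.coeff i V * coeffExt f ((n : ℤ) - i))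
    (Finset.range_subset_range.2 (by omega)) fun i _ hi => by
      rw [Finset.mem_range] at hi
      unfold coeffExt
      rw [if_neg (by omega), mul_zero]
  have h₃ := Finset.sum_subset (s₁ := Finset.range l) (s₂ := Finset.range (l + n.succ))
    (f := fun i : ℕ => PowerSeries.coeff i V * coeffExt f ((n : ℤ) - i))
    (Finset.range_subset_range.2 (by omega)) fun i _ hi => by
      rw [Finset.mem_range] at hi
      rw [hV i (by omega), zero_mul]
  rw [h₂, h₃]

theorem det_toeplitz_coeffExt_eq_zero_iff (f : PowerSeries F) (k l : ℕ) :
    (toeplitz (coeffExt f) k l).det = 0 ↔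
      ∃ V : PowerSeries F, V ≠ 0 ∧ (∀ n, l ≤ n → PowerSeries.coeff n V = 0) ∧
        ∀ n, k ≤ n → n < k + l → PowerSeries.coeff n (f * V) = 0 := by
  rw [← Matrix.exists_vecMul_eq_zero_iff]
  constructor
  · rintro ⟨v, hv, hv0⟩
    have hcoeff : ∀ i : Fin l, PowerSeries.coeff (i : ℕ)
        (PowerSeries.mk fun n => if h : n < l then v ⟨n, h⟩ else 0) = v i := by
      intro i
      simp
    have hV : ∀ n, l ≤ n → PowerSeries.coeff n
        (PowerSeries.mk fun n => if h : n < l then v ⟨n, h⟩ else 0) = 0 := by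
      intro n hn
      simp [hn.not_gt]
    refine ⟨_, fun h => hv ?_, hV, fun n hn hn' => ?_⟩
    · ext i
      rw [← hcoeff i, h]
      simp
    · rw [coeff_mul_eq_sum_coeffExt f _ hV]
      have := congrFun hv0 ⟨n - k, by omega⟩
      simp only [Matrix.vecMul, dotProduct, toeplitz, Matrix.of_apply, Pi.zero_apply] at this
      refine (Finset.sum_congr rfl fun i _ => ?_).trans this
      rw [hcoeff]
      congr 2
      omega
  · rintro ⟨V, hV0, hV, hfV⟩
    refine ⟨fun i => PowerSeries.coeff (i : ℕ) V, fun h => hV0 ?_, ?_⟩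
    · ext n
      rcases lt_or_ge n l with hn | hn
      · exact congrFun h ⟨n, hn⟩
      · simpa using hV n hn
    · ext j
      rw [Pi.zero_apply, ← hfV (k + j) (by omega) (by omega), coeff_mul_eq_sum_coeffExt f V hV]
      simp only [Matrix.vecMul, dotProduct, toeplitz, Matrix.of_apply]
      refine Finset.sum_congr rfl fun i _ => ?_
      congr 2
      omega

theorem det_toeplitz_eq_zero_of_mul_eq_one {f g : PowerSeries F} (hfg : g * f = 1) {k l : ℕ}
    (h : (toeplitz (coeffExt f) k l).det = 0) : (toeplitz (coeffExt g) l k).det = 0 := by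
  rw [det_toeplitz_coeffExt_eq_zero_iff] at h ⊢
  obtain ⟨V, hV0, hV, hfV⟩ := h
  have hW : ∀ n, k ≤ n → PowerSeries.coeff n ((PowerSeries.trunc k (f * V) : Polynomial F) :
      PowerSeries F) = 0 := by
    intro n hn
    rw [Polynomial.coeff_coe, PowerSeries.coeff_trunc, if_neg (by omega)]
  obtain ⟨R, hR⟩ : PowerSeries.X ^ (k + l) ∣
      f * V - ((PowerSeries.trunc k (f * V) : Polynomial F) : PowerSeries F) := by
    rw [PowerSeries.X_pow_dvd_iff]
    intro n hn
    rw [map_sub, Polynomial.coeff_coe, PowerSeries.coeff_trunc]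
    split_ifs with h
    · exact sub_self _
    · rw [hfV n (by omega) hn, sub_zero]
  have hVW : V - g * ((PowerSeries.trunc k (f * V) : Polynomial F) : PowerSeries F) =
      PowerSeries.X ^ (k + l) * (g * R) := by
    linear_combination g * hR - V * hfg
  have hcoeff : ∀ n, n < k + l → PowerSeries.coeff n
      (g * ((PowerSeries.trunc k (f * V) : Polynomial F) : PowerSeries F)) =
      PowerSeries.coeff n V := by
    intro n hn
    have := PowerSeries.X_pow_dvd_iff.1 (Dvd.intro _ hVW.symm) n hn
    rw [map_sub, sub_eq_zero] at this
    exact this.symm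
  refine ⟨_, fun h => hV0 ?_, hW, fun n hn hn' => ?_⟩
  · ext n
    rcases lt_or_ge n l with hn | hn
    · rw [← hcoeff n (by omega), h, mul_zero]
    · simpa using hV n hn
  · rw [hcoeff n (by omega), hV n hn]

theorem det_toeplitz_inv_eq_zero_iff {f : PowerSeries F} (hf : PowerSeries.constantCoeff f ≠ 0)
    (k l : ℕ) :
    (toeplitz (coeffExt f) k l).det = 0 ↔ (toeplitz (coeffExt f⁻¹) l k).det = 0 :=
  ⟨det_toeplitz_eq_zero_of_mul_eq_one (PowerSeries.inv_mul_cancel f hf),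
    det_toeplitz_eq_zero_of_mul_eq_one (PowerSeries.mul_inv_cancel f hf)⟩

/-- The polynomial with constant coefficient `u` and higher coefficients `b`. -/
noncomputable def consSeries {M : ℕ} (u : F) (b : Fin M → F) : PowerSeries F :=
  PowerSeries.mk fun n => tupleExt (Fin.cons u b : Fin (M + 1) → F) n

theorem coeffExt_consSeries {M : ℕ} (u : F) (b : Fin M → F) :
    coeffExt (consSeries u b) = tupleExt (Fin.cons u b : Fin (M + 1) → F) := by
  ext n
  unfold coeffExt
  split_ifs with h
  · rw [consSeries, PowerSeries.coeff_mk, Int.toNat_of_nonneg h]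
  · rw [tupleExt_of_neg _ (by omega)]

theorem constantCoeff_consSeries {M : ℕ} (u : F) (b : Fin M → F) :
    PowerSeries.constantCoeff (consSeries u b) = u := by
  rw [← PowerSeries.coeff_zero_eq_constantCoeff_apply, consSeries, PowerSeries.coeff_mk]
  exact tupleExt_cons_zero u b

theorem coeff_consSeries_succ {M : ℕ} (u : F) (b : Fin M → F) (i : Fin M) :
    PowerSeries.coeff (i + 1 : ℕ) (consSeries u b) = b i := by
  rw [consSeries, PowerSeries.coeff_mk, tupleExt_cons_of_ne_zero _ _ (by omega),
    ← tupleExt_natCast b i]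
  congr 1
  omega

/-- The higher coefficients of the truncated inverse of `consSeries u b`. -/
noncomputable def invTuple {M : ℕ} (u : F) (b : Fin M → F) : Fin M → F :=
  fun i => PowerSeries.coeff (i + 1 : ℕ) (consSeries u b)⁻¹

theorem invTuple_injective {M : ℕ} {u : F} (hu : u ≠ 0) :
    Function.Injective (invTuple u : (Fin M → F) → Fin M → F) := by
  intro b b' h
  have hb : consSeries u b * (consSeries u b)⁻¹ = 1 :=
    PowerSeries.mul_inv_cancel _ (by rwa [constantCoeff_consSeries])
  have hb' : consSeries u b' * (consSeries u b')⁻¹ = 1 :=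
    PowerSeries.mul_inv_cancel _ (by rwa [constantCoeff_consSeries])
  obtain ⟨R, hR⟩ : PowerSeries.X ^ (M + 1) ∣ (consSeries u b)⁻¹ - (consSeries u b')⁻¹ := by
    rw [PowerSeries.X_pow_dvd_iff]
    intro n hn
    rw [map_sub, sub_eq_zero]
    rcases n with _ | n
    · simp [constantCoeff_consSeries]
    · exact congrFun h ⟨n, by omega⟩
  have hdvd : PowerSeries.X ^ (M + 1) ∣ consSeries u b - consSeries u b' :=
    ⟨-(consSeries u b * consSeries u b' * R), by
      linear_combination consSeries u b' * hb - consSeries u b * hb' -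
        consSeries u b * consSeries u b' * hR⟩
  ext i
  have := PowerSeries.X_pow_dvd_iff.1 hdvd (i + 1) (by omega)
  rwa [map_sub, sub_eq_zero, coeff_consSeries_succ, coeff_consSeries_succ] at this

theorem coeffExt_inv_consSeries {M : ℕ} (u : F) (b : Fin M → F) {n : ℤ} (hn : 0 ≤ n)
    (hn' : n < M) : coeffExt (consSeries u b)⁻¹ (n + 1) = tupleExt (invTuple u b) n := by
  unfold coeffExt tupleExt
  rw [if_pos (by omega), dif_pos ⟨hn, hn'⟩, invTuple, show (n + 1).toNat = n.toNat + 1 by omega]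

/-- Truncated inversion exchanges rectangles with their conjugates. -/
theorem det_toeplitz_cons_eq_zero_iff {M : ℕ} {u : F} (hu : u ≠ 0) (b : Fin M → F) {k l : ℕ}
    (hkl : k ≤ l) (hM : k + l ≤ M + 1) :
    (toeplitz (tupleExt (Fin.cons u b : Fin (M + 1) → F)) k l).det = 0 ↔
      (toeplitz (tupleExt (invTuple u b)) (l - 1) k).det = 0 := by
  rw [← coeffExt_consSeries, det_toeplitz_inv_eq_zero_iff (by rwa [constantCoeff_consSeries])]
  rw [toeplitz_congr (a' := tupleExt (invTuple u b)) (k' := l - 1)]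
  intro d hd hd'
  rw [← coeffExt_inv_consSeries u b (by omega) (by omega)]
  congr 1
  omega

theorem det_toeplitz_cons_zero_ne_zero {M : ℕ} {u : F} (hu : u ≠ 0) (b : Fin M → F) (l : ℕ) :
    (toeplitz (tupleExt (Fin.cons u b : Fin (M + 1) → F)) 0 l).det ≠ 0 := by
  have htri : (toeplitz (tupleExt (Fin.cons u b : Fin (M + 1) → F)) 0 l).BlockTriangular id := by
    intro i j hij
    have : (j : ℕ) < i := hij
    exact tupleExt_of_neg _ (by omega)
  rw [Matrix.det_of_isUpperTriangular htri, Finset.prod_ne_zero_iff]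
  intro i _
  rw [toeplitz, Matrix.of_apply, zero_sub, neg_add_cancel, tupleExt_cons_zero]
  exact hu

theorem det_toeplitz_cons_zero_eq_zero {M : ℕ} (b : Fin M → F) {l : ℕ} (hl : 1 ≤ l) :
    (toeplitz (tupleExt (Fin.cons 0 b : Fin (M + 1) → F)) 0 l).det = 0 := by
  refine Matrix.det_eq_zero_of_column_eq_zero ⟨0, hl⟩ fun i => ?_
  rw [toeplitz, Matrix.of_apply]
  rcases Nat.eq_zero_or_pos i with hi | hi
  · simpa [hi] using tupleExt_cons_zero 0 b
  · exact tupleExt_of_neg _ (by simpa using hi)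

theorem tupleExt_cons_zero_left {M : ℕ} (b : Fin M → F) (n : ℤ) :
    tupleExt (Fin.cons 0 b : Fin (M + 1) → F) n = tupleExt b (n - 1) := by
  rcases eq_or_ne n 0 with rfl | hn
  · rw [tupleExt_cons_zero, tupleExt_of_neg _ (by omega)]
  · exact tupleExt_cons_of_ne_zero 0 b hn

/-- All the minors of sizes in `S` on a fixed diagonal of Toeplitz matrices of `a` vanish. -/
def JointlyVanish (a : ℤ → F) (j : ℤ) (S : Finset ℕ) : Prop :=
  ∀ l ∈ S, (toeplitz a ((l : ℤ) - 1 - j) l).det = 0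

theorem jointlyVanish_cons_zero {M : ℕ} (b : Fin M → F) {j : ℤ} {S : Finset ℕ}
    (hS : ∀ l ∈ S, 1 ≤ l) :
    JointlyVanish (tupleExt (Fin.cons 0 b : Fin (M + 1) → F)) j S ↔
      JointlyVanish (tupleExt b) (j + 1) (S.erase (j + 1).toNat) := by
  have key : ∀ l : ℕ, toeplitz (tupleExt (Fin.cons 0 b : Fin (M + 1) → F)) ((l : ℤ) - 1 - j) l =
      toeplitz (tupleExt b) ((l : ℤ) - 1 - (j + 1)) l := fun l =>
    toeplitz_congr fun d _ _ => by
      rw [tupleExt_cons_zero_left]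
      congr 1
      omega
  constructor
  · intro h l hl
    rw [← key]
    exact h l (Finset.mem_of_mem_erase hl)
  · intro h l hl
    by_cases hlj : l = (j + 1).toNat
    · have := hS l hl
      rw [show (l : ℤ) - 1 - j = 0 by omega]
      exact det_toeplitz_cons_zero_eq_zero b this
    · rw [key]
      exact h l (Finset.mem_erase.2 ⟨hlj, hl⟩)

theorem jointlyVanish_cons_of_neg {M : ℕ} (u : F) (b : Fin M → F) {j : ℤ} (hj : j < 0)
    (S : Finset ℕ) :
    JointlyVanish (tupleExt (Fin.cons u b : Fin (M + 1) → F)) j S ↔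
      JointlyVanish (tupleExt b) (j + 1) S := by
  refine forall₂_congr fun l _ => ?_
  rw [toeplitz_congr (a' := tupleExt b) (k' := (l : ℤ) - 1 - (j + 1))]
  intro d _ _
  rw [tupleExt_cons_of_ne_zero _ _ (by omega)]
  congr 1
  omega

theorem jointlyVanish_cons_of_nonneg {M : ℕ} {u : F} (hu : u ≠ 0) (b : Fin M → F) (m : ℕ)
    {S : Finset ℕ} (hS : ∀ l ∈ S, m + 1 < l ∧ 2 * l ≤ M + 2 + m) :
    JointlyVanish (tupleExt (Fin.cons u b : Fin (M + 1) → F)) m S ↔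
      JointlyVanish (tupleExt (invTuple u b)) (-1 - m) (S.image fun l => l - 1 - m) := by
  unfold JointlyVanish
  rw [Finset.forall_mem_image]
  refine forall₂_congr fun l hl => ?_
  have := hS l hl
  rw [show (l : ℤ) - 1 - m = (l - 1 - m : ℕ) by omega,
    det_toeplitz_cons_eq_zero_iff hu b (by omega) (by omega),
    show ((l - 1 - m : ℕ) : ℤ) - 1 - (-1 - m) = l - 1 by omega]

theorem card_jointlyVanish_cons [Fintype F] {M : ℕ}
    (hM : ∀ (j : ℤ) (S : Finset ℕ), (∀ l ∈ S, 1 ≤ l ∧ j < l ∧ 2 * (l : ℤ) ≤ M + 1 + j) →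
      Nat.card {b : Fin M → F // JointlyVanish (tupleExt b) j S} * Fintype.card F ^ #S =
        Fintype.card F ^ M)
    {u : F} (hu : u ≠ 0) (j : ℤ) (S : Finset ℕ)
    (hS : ∀ l ∈ S, 1 ≤ l ∧ j + 1 < l ∧ 2 * (l : ℤ) ≤ M + 2 + j) :
    Nat.card {b : Fin M → F //
        JointlyVanish (tupleExt (Fin.cons u b : Fin (M + 1) → F)) j S} * Fintype.card F ^ #S =
      Fintype.card F ^ M := by
  rcases lt_or_ge j 0 with hj | hj
  · simp_rw [jointlyVanish_cons_of_neg u _ hj S]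
    refine hM _ _ fun l hl => ?_
    have := hS l hl
    omega
  · lift j to ℕ using hj
    have hcard : #(S.image fun l => l - 1 - j) = #S := by
      refine Finset.card_image_of_injOn fun l hl l' hl' h => ?_
      have := hS l hl
      have := hS l' hl'
      omega
    have hbij : Function.Bijective (invTuple u : (Fin M → F) → Fin M → F) :=
      Finite.injective_iff_bijective.1 (invTuple_injective hu)
    rw [Nat.card_congr ((Equiv.ofBijective _ hbij).subtypeEquiv
      (q := fun b => JointlyVanish (tupleExt b) (-1 - j) (S.image fun l => l - 1 - j)) fun b =>
      jointlyVanish_cons_of_nonneg hu b j fun l hl => by have := hS l hl; omega), ← hcard]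
    refine hM _ _ ?_
    rw [Finset.forall_mem_image]
    intro l hl
    have := hS l hl
    omega

theorem card_jointlyVanish [Fintype F] (M : ℕ) (j : ℤ) (S : Finset ℕ)
    (hS : ∀ l ∈ S, 1 ≤ l ∧ j < l ∧ 2 * (l : ℤ) ≤ M + 1 + j) :
    Nat.card {b : Fin M → F // JointlyVanish (tupleExt b) j S} * Fintype.card F ^ #S =
      Fintype.card F ^ M := by
  induction M generalizing j S with
  | zero =>
    have hS0 : S = ∅ := Finset.eq_empty_of_forall_notMem fun l hl => by
      have := hS l hl
      omega
    simp [hS0, JointlyVanish]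
  | succ M ih =>
    have hzero := ih (j + 1) (S.erase (j + 1).toNat) fun l hl => by
      obtain ⟨hne, hl⟩ := Finset.mem_erase.1 hl
      have := hS l hl
      omega
    rw [card_subtype_fin_succ, ← Finset.add_sum_erase _ _ (Finset.mem_univ (0 : F))]
    simp_rw [jointlyVanish_cons_zero _ fun l hl => (hS l hl).1]
    by_cases hj : 0 ≤ j ∧ (j + 1).toNat ∈ S
    · rw [Finset.sum_eq_zero, add_zero, ← Finset.card_erase_add_one hj.2, pow_succ, ← mul_assoc,
        hzero, ← pow_succ]
      intro u hu
      rw [Nat.card_eq_zero]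
      refine Or.inl ⟨fun b => det_toeplitz_cons_zero_ne_zero (Finset.ne_of_mem_erase hu) b.1
        (j + 1).toNat ?_⟩
      have := b.2 _ hj.2
      rwa [show ((j + 1).toNat : ℤ) - 1 - j = 0 by omega] at this
    · have hmem : (j + 1).toNat ∉ S := fun h => by
        have := hS _ h
        exact hj ⟨by omega, h⟩
      rw [Finset.erase_eq_of_notMem hmem] at hzero ⊢
      have hS' : ∀ l ∈ S, 1 ≤ l ∧ j + 1 < l ∧ 2 * (l : ℤ) ≤ M + 2 + j := fun l hl => by
        have := hS l hl
        have : l ≠ (j + 1).toNat := fun h => hmem (h ▸ hl)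
        omega
      rw [add_mul, hzero, Finset.sum_mul, Finset.sum_congr rfl fun u hu =>
        card_jointlyVanish_cons ih (Finset.ne_of_mem_erase hu) j S hS']
      rw [Finset.add_sum_erase _ (fun _ => Fintype.card F ^ M) (Finset.mem_univ (0 : F)),
        Finset.sum_const, Finset.card_univ, smul_eq_mul, pow_succ']

theorem JTmat_rectangle_eq_toeplitz {N : ℕ} (b : Fin N → F) (k l : ℕ) :
    JTmat F l (fun _ => k) (extFin b) =
      toeplitz (tupleExt (Fin.cons 1 b : Fin (N + 1) → F)) k l := by
  ext i j
  rw [JTmat, toeplitz, Matrix.of_apply, Matrix.of_apply]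
  generalize (k : ℤ) - i + j = n
  split_ifs with h₁ h₀
  · rw [tupleExt_cons_of_ne_zero _ _ (by omega)]
    unfold extFin tupleExt
    by_cases h : n ≤ N
    · rw [dif_pos (by omega), dif_pos (by omega)]
      congr 2
      omega
    · rw [dif_neg (by omega), dif_neg (by omega)]
  · rw [h₀, tupleExt_cons_zero]
  · rw [tupleExt_of_neg _ (by omega)]

/-- The joint vanishing probability of `r` distinct rectangles is `1 / q ^ r` for every number
of variables that is large enough. -/
theorem probJoint_rectangles [Fintype F] (c : ℤ) {r : ℕ} (kk ll : Fin r → ℕ)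
    (hk : ∀ i, 1 ≤ kk i) (hl : ∀ i, 1 ≤ ll i) (hc : ∀ i, (kk i : ℤ) - ll i = c)
    (hinj : Function.Injective kk) {N : ℕ} (hN : ∀ i, kk i + (ll i - 1) ≤ N) :
    probJoint F (fun i => ll i) (fun i => fun _ => kk i) N = 1 / (Fintype.card F : ℚ) ^ r := by
  have hcard : #(Finset.univ.image ll) = r := by
    rw [Finset.card_image_of_injective, Finset.card_univ, Fintype.card_fin]
    intro i i' h
    have := hc i
    have := hc i'
    exact hinj (by omega)
  have hcount := card_jointlyVanish_cons (card_jointlyVanish N) (one_ne_zero (α := F)) (-1 - c)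
    (Finset.univ.image ll) (by
      rw [Finset.forall_mem_image]
      intro i _
      have := hk i
      have := hl i
      have := hc i
      have := hN i
      omega)
  have hiff : ∀ b : Fin N → F, (∀ i, (JTmat F (ll i) (fun _ => kk i) (extFin b)).det = 0) ↔
      JointlyVanish (tupleExt (Fin.cons 1 b : Fin (N + 1) → F)) (-1 - c)
        (Finset.univ.image ll) := by
    intro b
    unfold JointlyVanish
    rw [Finset.forall_mem_image]
    simp only [Finset.mem_univ, forall_const]
    refine forall_congr' fun i => ?_
    rw [JTmat_rectangle_eq_toeplitz, show (ll i : ℤ) - 1 - (-1 - c) = kk i by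
      rw [← hc i]
      ring]
  have hq : (Fintype.card F : ℚ) ≠ 0 := by exact_mod_cast Fintype.card_ne_zero
  unfold probJoint
  rw [← Fintype.card_subtype, ← Nat.card_eq_fintype_card]
  simp_rw [hiff]
  rw [div_eq_div_iff (pow_ne_zero _ hq) (pow_ne_zero _ hq), one_mul]
  rw [hcard] at hcount
  exact_mod_cast hcount

theorem probEq_rectangle [Fintype F] {k l : ℕ} (hk : 1 ≤ k) (hl : 1 ≤ l) :
    probEq F l (fun _ => k) (k + (l - 1)) (0 : F) = 1 / (Fintype.card F : ℚ) := by
  have := probJoint_rectangles (F := F) ((k : ℤ) - l) (fun _ : Fin 1 => k) (fun _ => l)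
    (fun _ => hk) (fun _ => hl) (fun _ => rfl) (Function.injective_of_subsingleton _)
    (fun _ => le_rfl)
  rw [pow_one] at this
  rw [← this]
  unfold probEq probJoint
  simp only [forall_const]

end

/-- The vanishing events for the family of rectangles `(k^ℓ)` with `k − ℓ = c` are
set-wise independent: for distinct rectangles `λ⁽¹⁾, …, λ⁽ʳ⁾` from the family, the
joint vanishing probability is `1/qʳ`, the product of the individual probabilities. -/
theorem rectangles_fixed_difference_independent (F : Type*) [Field F] [Fintype F]
    (c : ℤ) (r : ℕ) (kk ll : Fin r → ℕ)
    (hk : ∀ i, 1 ≤ kk i) (hl : ∀ i, 1 ≤ ll i)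
    (hc : ∀ i, (kk i : ℤ) - (ll i : ℤ) = c)
    (hdist : ∀ i j, i ≠ j → kk i ≠ kk j) :
    probJoint F (fun i => ll i) (fun i => fun _ => kk i)
        (Finset.univ.sup fun i => kk i + (ll i - 1)) =
      1 / (Fintype.card F : ℚ) ^ r ∧
    probJoint F (fun i => ll i) (fun i => fun _ => kk i)
        (Finset.univ.sup fun i => kk i + (ll i - 1)) =
      ∏ i : Fin r, probEq F (ll i) (fun _ => kk i) (kk i + (ll i - 1)) (0 : F) := by

  have hjoint := probJoint_rectangles (F := F) c kk ll hk hl hc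
    (fun i j h => by_contra fun hij => hdist i j hij h)
    (N := Finset.univ.sup fun i => kk i + (ll i - 1))
    (fun i => Finset.le_sup (f := fun i => kk i + (ll i - 1)) (Finset.mem_univ i))
  refine ⟨hjoint, hjoint.trans ?_⟩
  rw [Finset.prod_congr rfl fun i _ => probEq_rectangle (hk i) (hl i), Finset.prod_const,
    Finset.card_univ, Fintype.card_fin, one_div_pow]
end
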